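/- Let Γ and Δ be countable discrete groups and let m, n ≥ 2 be finite. If A is any Borel subset of Free((m+n−1)^{Γ*Δ}) (where m+n−1 denotes a set of that finite cardinality), then at least one of the following holds: (1) there is an injective Borel function f : Free(n^Γ) → Free((m+n−1)^{Γ*Δ}) that is equivariant with respect to the left shift actions of Γ and such that ran(f) ⊆ A; or (2) there is an injective Borel function f : Free(m^Δ) → Free((m+n−1)^{Γ*Δ}) that is equivariant with respect to the left shift actions of Δ and such that ran(f) is contained in the complement of A. -/

import Mathlib

/-- The left shift action of a group `G` on the product space `G → X`:
`(γ • y) β = y (γ⁻¹ * β)`. -/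
def shift {G : Type*} [Group G] {X : Type*} (γ : G) (y : G → X) : G → X :=
  fun β => y (γ⁻¹ * β)

/-- The free part `Free(X^G)` of the left shift action of `G` on `G → X`. -/
def freePart (G : Type*) [Group G] (X : Type*) : Set (G → X) :=
  {y | ∀ γ : G, γ ≠ 1 → shift γ y ≠ y}

/-- A game tree without terminal positions, presented by its sets of positions of each length
together with the restriction maps between them. -/
structure GameTree where
  Pos : ℕ → Type
  res : ∀ {m n : ℕ}, m ≤ n → Pos n → Pos m
  res_self : ∀ {n : ℕ} (h : n ≤ n) (p : Pos n), res h p = p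
  res_res : ∀ {l m n : ℕ} (h₁ : l ≤ m) (h₂ : m ≤ n) (p : Pos n),
    res h₁ (res h₂ p) = res (h₁.trans h₂) p
  exists_succ : ∀ {n : ℕ} (p : Pos n), ∃ q : Pos (n + 1), res n.le_succ q = p

namespace GameTree

/-- Player `false` moves at even positions, player `true` at odd positions. -/
def Turn (j : Bool) (n : ℕ) : Prop := n.bodd = j

theorem turn_succ {j : Bool} {n : ℕ} : Turn j (n + 1) ↔ ¬ Turn j n := by
  unfold Turn
  rw [Nat.bodd_succ]
  cases n.bodd <;> cases j <;> simp

theorem not_turn {j : Bool} {n : ℕ} : ¬ Turn j n ↔ Turn (!j) n := by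
  unfold Turn
  cases n.bodd <;> cases j <;> simp

/-- An infinite branch of a game tree. -/
@[ext]
structure Run (T : GameTree) where
  pos : ∀ n, T.Pos n
  res_pos : ∀ {m n : ℕ} (h : m ≤ n), T.res h (pos n) = pos m

/-- A rule selecting a move at every position; each player only uses the moves at their own
turns. -/
@[ext]
structure Strategy (T : GameTree) where
  move : ∀ n, T.Pos n → T.Pos (n + 1)
  res_move : ∀ n p, T.res n.le_succ (move n p) = p

variable {T : GameTree}

theorem Run.pos_eq_of_le {x y : T.Run} {m n : ℕ} (h : m ≤ n) (e : x.pos n = y.pos n) :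
    x.pos m = y.pos m := by
  rw [← x.res_pos h, ← y.res_pos h, e]

/-- The run `x` follows the strategy `s` of player `j` from time `b` on. -/
def Run.Follows (x : T.Run) (j : Bool) (s : T.Strategy) (b : ℕ) : Prop :=
  ∀ n, b ≤ n → Turn j n → x.pos (n + 1) = s.move n (x.pos n)

/-- An arbitrary successor of a position. -/
noncomputable def succ (n : ℕ) (p : T.Pos n) : T.Pos (n + 1) := (T.exists_succ p).choose

theorem res_succ (n : ℕ) (p : T.Pos n) : T.res n.le_succ (succ n p) = p :=
  (T.exists_succ p).choose_spec

variable (T) in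
/-- An arbitrary strategy. -/
noncomputable def defaultStrategy : T.Strategy := ⟨succ, res_succ⟩

/-- A set of runs is open if membership is witnessed by finite positions. -/
def IsOpenSet (X : Set T.Run) : Prop :=
  ∀ x ∈ X, ∃ n, ∀ y : T.Run, y.pos n = x.pos n → y ∈ X

/-- A set of runs is clopen if both it and its complement are open. -/
def IsClopenSet (X : Set T.Run) : Prop := IsOpenSet X ∧ IsOpenSet Xᶜ

variable (T) in
/-- A set of positions of arbitrary length. -/
abbrev PosSet := ∀ n, Set (T.Pos n)

/-- Player `j` can force the play to hit the set `X` from the position `p`. -/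
def Forces (j : Bool) (X : T.PosSet) (n : ℕ) (p : T.Pos n) : Prop :=
  ∃ s : T.Strategy, ∀ x : T.Run, x.pos n = p → x.Follows j s n → ∃ m, x.pos m ∈ X m

theorem forces_of_mem {j : Bool} {X : T.PosSet} {n : ℕ} {p : T.Pos n} (h : p ∈ X n) :
    Forces j X n p :=
  ⟨defaultStrategy T, fun _ hx _ => ⟨n, hx ▸ h⟩⟩

theorem forces_of_succ {j : Bool} {X : T.PosSet} {n : ℕ} {p : T.Pos n} (hn : Turn j n)
    (q : T.Pos (n + 1)) (hq : T.res n.le_succ q = p) (h : Forces j X (n + 1) q) :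
    Forces j X n p := by
  classical
  obtain ⟨s, hs⟩ := h
  refine ⟨⟨Function.update s.move n (fun a => if a = p then q else s.move n a), ?_⟩, ?_⟩
  · intro m a
    by_cases hm : m = n
    · subst hm
      simp only [Function.update_self]
      split_ifs with ha
      · rw [hq, ha]
      · exact s.res_move _ _
    · rw [Function.update_of_ne hm]
      exact s.res_move _ _
  · intro x hx hf
    refine hs x ?_ ?_
    · rw [hf n le_rfl hn]
      simp [hx]
    · intro m hm htm
      rw [hf m (by omega) htm]
      simp only
      rw [Function.update_of_ne (by omega)]

open Classical in
/-- A strategy forcing the play into `X` from `u`, if there is one. -/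
noncomputable def forceStrategy (j : Bool) (X : T.PosSet) (u : Σ m, T.Pos m) : T.Strategy :=
  if h : Forces j X u.1 u.2 then Exists.choose h else defaultStrategy T

theorem forceStrategy_spec {j : Bool} {X : T.PosSet} {n : ℕ} {p : T.Pos n}
    (h : Forces j X n p) (x : T.Run) (hx : x.pos n = p)
    (hf : x.Follows j (forceStrategy j X ⟨n, p⟩) n) : ∃ m, x.pos m ∈ X m := by
  rw [forceStrategy, dif_pos h] at hf
  exact Exists.choose_spec h x hx hf

theorem forces_of_forall {j : Bool} {X : T.PosSet} {n : ℕ} {p : T.Pos n}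
    (h : ∀ q : T.Pos (n + 1), T.res n.le_succ q = p → Forces j X (n + 1) q) :
    Forces j X n p := by
  classical
  refine ⟨⟨fun m a => if hm : n + 1 ≤ m then
    (forceStrategy j X ⟨n + 1, T.res hm a⟩).move m a else succ m a, ?_⟩, ?_⟩
  · intro m a
    split_ifs with h
    · exact Strategy.res_move _ _ _
    · exact res_succ _ _
  · intro x hx hf
    have hq := h (x.pos (n + 1)) (by rw [x.res_pos, hx])
    refine forceStrategy_spec hq x rfl fun m hm htm => ?_
    rw [hf m (by omega) htm]
    dsimp only
    rw [dif_pos hm, x.res_pos]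

/-- An initial segment of `p` of length at least `b` lies in `X`. -/
abbrev Hits (X : T.PosSet) (b : ℕ) {n : ℕ} (p : T.Pos n) : Prop :=
  ∃ m, ∃ h : m ≤ n, b ≤ m ∧ T.res h p ∈ X m

open Classical in
/-- The shortest initial segment of `p` of length at least `b` that lies in `X`. -/
noncomputable def firstHit (X : T.PosSet) (b : ℕ) {n : ℕ} (p : T.Pos n) : Σ m, T.Pos m :=
  if h : Hits X b p then ⟨Nat.find h, T.res (Nat.find_spec h).choose p⟩ else ⟨n, p⟩

theorem firstHit_run {X : T.PosSet} {b : ℕ} (x : T.Run) {m n : ℕ} (hb : b ≤ m)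
    (hm : x.pos m ∈ X m) (hmin : ∀ m' < m, b ≤ m' → x.pos m' ∉ X m') (hn : m ≤ n) :
    Hits X b (x.pos n) ∧ firstHit X b (x.pos n) = ⟨m, x.pos m⟩ := by
  classical
  have h : Hits X b (x.pos n) := ⟨m, hn, hb, by rwa [x.res_pos]⟩
  refine ⟨h, ?_⟩
  have e : Nat.find h = m := by
    rw [Nat.find_eq_iff]
    refine ⟨⟨hn, hb, by rwa [x.res_pos]⟩, ?_⟩
    rintro m' hm' ⟨h1, h2, h3⟩
    rw [x.res_pos] at h3
    exact hmin m' hm' h2 h3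
  rw [firstHit, dif_pos h, x.res_pos, e]

theorem not_hits_run {X : T.PosSet} {b : ℕ} (x : T.Run) {n : ℕ}
    (h : ∀ m ≤ n, b ≤ m → x.pos m ∉ X m) : ¬ Hits X b (x.pos n) := by
  rintro ⟨m, hm, hb, h'⟩
  rw [x.res_pos] at h'
  exact h m hm hb h'

open Classical in
/-- Play `f₀` until reaching a position from which `X` can be forced, then force `X`, and after the
first visit to `X` at `u` play `f₁ u`. -/
noncomputable def splice (j : Bool) (X : T.PosSet) (b n : ℕ)
    (f₁ : (Σ m, T.Pos m) → T.Pos n → T.Pos (n + 1)) (f₀ : T.Pos n → T.Pos (n + 1))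
    (p : T.Pos n) : T.Pos (n + 1) :=
  if Hits X b p then f₁ (firstHit X b p) p
  else if Hits (Forces j X) b p then
    (forceStrategy j X (firstHit (Forces j X) b p)).move n p
  else f₀ p

theorem res_splice (j : Bool) (X : T.PosSet) (b n : ℕ)
    (f₁ : (Σ m, T.Pos m) → T.Pos n → T.Pos (n + 1)) (f₀ : T.Pos n → T.Pos (n + 1))
    (p : T.Pos n) (h₁ : ∀ u, T.res n.le_succ (f₁ u p) = p) (h₀ : T.res n.le_succ (f₀ p) = p) :
    T.res n.le_succ (splice j X b n f₁ f₀ p) = p := by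
  unfold splice
  split_ifs
  · exact h₁ _
  · exact Strategy.res_move _ _ _
  · exact h₀

theorem splice_run {j : Bool} {X : T.PosSet} {b : ℕ}
    {f₁ : ∀ n, (Σ m, T.Pos m) → T.Pos n → T.Pos (n + 1)} {f₀ : ∀ n, T.Pos n → T.Pos (n + 1)}
    (hX : ∀ m, ∀ p ∈ X m, b ≤ m) (x : T.Run)
    (hx : ∀ n, b ≤ n → Turn j n → x.pos (n + 1) = splice j X b n (f₁ n) (f₀ n) (x.pos n)) :
    (∃ m, b ≤ m ∧ x.pos m ∈ X m ∧
      ∀ n, m ≤ n → Turn j n → x.pos (n + 1) = f₁ n ⟨m, x.pos m⟩ (x.pos n)) ∨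
    ((∀ m, b ≤ m → ¬ Forces j X m (x.pos m)) ∧
      ∀ n, b ≤ n → Turn j n → x.pos (n + 1) = f₀ n (x.pos n)) := by
  classical
  by_cases h : ∃ m, b ≤ m ∧ x.pos m ∈ X m
  · left
    obtain ⟨h1, h2⟩ := Nat.find_spec h
    have hmin : ∀ m' < Nat.find h, b ≤ m' → x.pos m' ∉ X m' := fun m' hm' hb hX =>
      Nat.find_min h hm' ⟨hb, hX⟩
    refine ⟨Nat.find h, h1, h2, fun n hn ht => ?_⟩
    obtain ⟨h3, h4⟩ := firstHit_run x h1 h2 hmin hn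
    rw [hx n (h1.trans hn) ht, splice, if_pos h3, h4]
  · right
    push Not at h
    have hF : ∀ m, b ≤ m → ¬ Forces j X m (x.pos m) := by
      by_contra hF
      push Not at hF
      obtain ⟨h1, h2⟩ := Nat.find_spec hF
      have hmin : ∀ m' < Nat.find hF, b ≤ m' → ¬ Forces j X m' (x.pos m') :=
        fun m' hm' hb hX => Nat.find_min hF hm' ⟨hb, hX⟩
      set m := Nat.find hF
      obtain ⟨k, hk⟩ := forceStrategy_spec h2 x rfl (fun n hn ht => by
        obtain ⟨h3, h4⟩ := firstHit_run (X := Forces j X) x h1 h2 hmin hn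
        rw [hx n (h1.trans hn) ht, splice, if_neg (not_hits_run x fun m _ hb => h m hb),
          if_pos h3, h4])
      exact h k (hX k _ hk) hk
    refine ⟨hF, fun n hn ht => ?_⟩
    rw [hx n hn ht, splice, if_neg (not_hits_run x fun m _ hb => h m hb),
      if_neg (not_hits_run (X := Forces j X) x fun m _ hb => hF m hb)]

end GameTree

namespace GameTree

variable {T : GameTree}

/-- A covering of `T` by `S`: a map of positions together with a local way of turning strategies
for `S` into strategies for `T` such that runs following the latter lift to runs following the
former. The two games agree up to time `k`. -/
structure Covering (S T : GameTree) (k : ℕ) where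
  map : ∀ n, S.Pos n → T.Pos n
  res_map : ∀ {m n : ℕ} (h : m ≤ n) (p : S.Pos n), T.res h (map n p) = map m (S.res h p)
  lift : Bool → S.Strategy → T.Strategy
  lift_local : ∀ j s s' n, (∀ m ≤ n, s.move m = s'.move m) →
    (lift j s).move n = (lift j s').move n
  lift_run : ∀ j s (x : T.Run), x.Follows j (lift j s) 0 →
    ∃ y : S.Run, y.Follows j s 0 ∧ ∀ n, map n (y.pos n) = x.pos n
  map_bijective : ∀ n ≤ k, Function.Bijective (map n)
  lift_map : ∀ j s n, n < k → ∀ p : S.Pos n,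
    (lift j s).move n (map n p) = map (n + 1) (s.move n p)

/-- The action of a covering on runs. -/
def Covering.mapRun {S T : GameTree} {k : ℕ} (c : Covering S T k) (x : S.Run) : T.Run where
  pos n := c.map n (x.pos n)
  res_pos h := by rw [c.res_map, x.res_pos]

/-- `A` is closed under the moves of player `true` and contains a move of player `false` at each of
its positions. -/
structure IsQuasi (A : T.PosSet) : Prop where
  all : ∀ n, Turn true n → ∀ p ∈ A n, ∀ q, T.res n.le_succ q = p → q ∈ A (n + 1)
  some : ∀ n, Turn false n → ∀ p ∈ A n, ∃ q ∈ A (n + 1), T.res n.le_succ q = p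

/-- `S` is a subset of `A` avoiding `W`, is closed under those moves of player `false` that stay in
`A`, and contains a move of player `true` at each of its positions. -/
structure IsCounterQuasi (W A S : T.PosSet) : Prop where
  subset : ∀ n, S n ⊆ A n
  avoid : ∀ n, ∀ p ∈ S n, p ∉ W n
  all : ∀ n, Turn false n → ∀ p ∈ S n, ∀ q ∈ A (n + 1), T.res n.le_succ q = p → q ∈ S (n + 1)
  some : ∀ n, Turn true n → ∀ p ∈ S n, ∃ q ∈ S (n + 1), T.res n.le_succ q = p

/-- Validity of the answer of player `true` in the auxiliary game: either a position `u` in `W` that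
has to be reached, or a restriction of both players to positions outside `W`. -/
def ValidAnswer (W : T.PosSet) (K : ℕ) (A : T.PosSet) (n : ℕ) (p : T.Pos n) :
    (Σ m, T.Pos m) ⊕ T.PosSet → Prop
  | .inl u => K + 2 ≤ u.1 ∧ u.2 ∈ A u.1 ∧ u.2 ∈ W u.1 ∧
      ∀ m (h₁ : m ≤ n) (h₂ : m ≤ u.1), T.res h₁ p = T.res h₂ u.2
  | .inr S => IsCounterQuasi W A S ∧ ∀ m (h : m ≤ n), K + 2 ≤ m → T.res h p ∈ S m

/-- Positions of the auxiliary game unravelling the open set with witnesses `W`. -/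
@[ext]
structure AuxPos (T : GameTree) (W : T.PosSet) (K n : ℕ) where
  pos : T.Pos n
  offer : K < n → T.PosSet
  answer : K + 1 < n → (Σ m, T.Pos m) ⊕ T.PosSet
  isQuasi : ∀ h, IsQuasi (offer h)
  mem_offer : ∀ h : K < n, T.res h pos ∈ offer h (K + 1)
  valid : ∀ h, ValidAnswer W K (offer (by omega)) n pos (answer h)

theorem ValidAnswer.res {W : T.PosSet} {K : ℕ} {A : T.PosSet} {m n : ℕ} (h : m ≤ n)
    {p : T.Pos n} {b : (Σ m, T.Pos m) ⊕ T.PosSet} (hb : ValidAnswer W K A n p b) :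
    ValidAnswer W K A m (T.res h p) b := by
  cases b with
  | inl u =>
    refine ⟨hb.1, hb.2.1, hb.2.2.1, fun l h1 h2 => ?_⟩
    rw [T.res_res]
    exact hb.2.2.2 l _ _
  | inr S =>
    refine ⟨hb.1, fun l h1 h2 => ?_⟩
    rw [T.res_res]
    exact hb.2 l _ h2

/-- Restriction of positions of the auxiliary game. -/
def AuxPos.res {W : T.PosSet} {K m n : ℕ} (h : m ≤ n) (p : AuxPos T W K n) : AuxPos T W K m where
  pos := T.res h p.pos
  offer hm := p.offer (by omega)
  answer hm := p.answer (by omega)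
  isQuasi hm := p.isQuasi _
  mem_offer hm := by
    rw [T.res_res]
    exact p.mem_offer _
  valid hm := (p.valid _).res h

theorem isQuasi_univ : IsQuasi (T := T) (fun _ => Set.univ) where
  all _ _ _ _ _ _ := trivial
  some _ _ p _ := (T.exists_succ p).imp fun _ hq => ⟨trivial, hq⟩

theorem exists_answer {W : T.PosSet} (hW : ∀ m n (h : m ≤ n) p, T.res h p ∈ W m → p ∈ W n)
    {K : ℕ} (hK : Turn false K) {A : T.PosSet} (hA : IsQuasi A) (p : T.Pos (K + 1))
    (hp : p ∈ A (K + 1)) :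
    ∃ (q : T.Pos (K + 2)) (b : (Σ m, T.Pos m) ⊕ T.PosSet),
      T.res (K + 1).le_succ q = p ∧ ValidAnswer W K A (K + 2) q b := by
  have hK1 : Turn true (K + 1) := turn_succ.2 (not_turn.2 hK)
  by_cases h : ∃ (m : ℕ) (hm : K + 1 ≤ m) (u : T.Pos m), u ∈ A m ∧ u ∈ W m ∧ T.res hm u = p
  · obtain ⟨m, hm, u, huA, huW, hup⟩ := h
    have key : ∃ (m : ℕ) (hm : K + 2 ≤ m) (u : T.Pos m), u ∈ A m ∧ u ∈ W m ∧
        T.res (show K + 1 ≤ m by omega) u = p := by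
      rcases hm.eq_or_lt with rfl | hlt
      · rw [T.res_self] at hup
        subst hup
        obtain ⟨q, hq⟩ := T.exists_succ u
        exact ⟨K + 2, le_rfl, q, hA.all _ hK1 u huA q hq, hW _ _ _ q (by rwa [hq]), hq⟩
      · exact ⟨m, hlt, u, huA, huW, hup⟩
    obtain ⟨m, hm, u, huA, huW, hup⟩ := key
    refine ⟨T.res hm u, .inl ⟨m, u⟩, ?_, hm, huA, huW, ?_⟩
    · rw [T.res_res, hup]
    · intro l h1 h2
      rw [T.res_res]
  · push Not at h
    obtain ⟨q, hq⟩ := T.exists_succ p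
    refine ⟨q, .inr fun n => {r | K + 1 ≤ n ∧ r ∈ A n ∧ ∀ m (hm : n ≤ m) (u : T.Pos m), u ∈ A m →
      T.res hm u = r → u ∉ W m} ∩ {r | ∃ h : K + 1 ≤ n, T.res h r = p}, hq, ?_, ?_⟩
    · constructor
      · rintro n r ⟨⟨-, h, -⟩, -⟩
        exact h
      · rintro n r ⟨⟨-, h, h'⟩, -⟩
        exact h' n le_rfl r h (T.res_self _ _)
      · rintro n hn r ⟨⟨h1, h2, h3⟩, h4, h5⟩ s hs hsr
        refine ⟨⟨by omega, hs, fun m hm u hu hus => h3 m (by omega) u hu ?_⟩, by omega, ?_⟩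
        · rw [← hsr, ← hus, T.res_res]
        · rw [← h5, ← hsr, T.res_res]
      · rintro n hn r ⟨⟨h1, h2, h3⟩, h4, h5⟩
        obtain ⟨s, hsr⟩ := T.exists_succ r
        refine ⟨s, ⟨⟨by omega, hA.all n hn r h2 s hsr,
          fun m hm u hu hus => h3 m (by omega) u hu ?_⟩, by omega, ?_⟩, hsr⟩
        · rw [← hsr, ← hus, T.res_res]
        · rw [← h5, ← hsr, T.res_res]
    · intro m hm1 hm2
      obtain rfl : m = K + 2 := by omega
      rw [T.res_self]
      have hqA := hA.all _ hK1 p hp q hq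
      refine ⟨⟨by omega, hqA, fun m hm u hu huq huW => h m (by omega) u hu huW ?_⟩, by omega, hq⟩
      rw [← hq, ← huq, T.res_res]

theorem AuxPos.exists_succ {W : T.PosSet} (hW : ∀ m n (h : m ≤ n) p, T.res h p ∈ W m → p ∈ W n)
    {K : ℕ} (hK : Turn false K) {n : ℕ} (p : AuxPos T W K n) :
    ∃ q : AuxPos T W K (n + 1), q.res n.le_succ = p := by
  obtain ⟨q, hq⟩ := T.exists_succ p.pos
  rcases lt_trichotomy n K with h | rfl | h
  · refine ⟨⟨q, fun h' => by omega, fun h' => by omega, fun h' => by omega, fun h' => by omega,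
      fun h' => by omega⟩, ?_⟩
    ext1
    · exact hq
    · funext h'
      omega
    · funext h'
      omega
  · refine ⟨⟨q, fun _ _ => Set.univ, fun h' => by omega, fun _ => isQuasi_univ,
      fun _ => trivial, fun h' => by omega⟩, ?_⟩
    ext1
    · exact hq
    · funext h'
      omega
    · funext h'
      omega
  · rcases (show K + 1 ≤ n from h).eq_or_lt with rfl | h
    · have := p.mem_offer (by omega)
      rw [T.res_self] at this
      obtain ⟨q, b, hq, hb⟩ := exists_answer hW hK (p.isQuasi (by omega)) p.pos this
      refine ⟨⟨q, fun _ => p.offer (by omega), fun _ => b, fun _ => p.isQuasi _, fun _ => ?_,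
        fun _ => hb⟩, ?_⟩
      · rwa [hq]
      · ext1
        · exact hq
        · rfl
        · funext h'
          omega
    · have hv := p.valid h
      have hO := p.mem_offer (by omega)
      have key : ∃ q, T.res n.le_succ q = p.pos ∧
          ValidAnswer W K (p.offer (by omega)) (n + 1) q (p.answer h) := by
        match p.answer h, hv with
        | .inl u, hv =>
          by_cases hn : n + 1 ≤ u.1
          · refine ⟨T.res hn u.2, ?_, hv.1, hv.2.1, hv.2.2.1, fun m h1 h2 => by rw [T.res_res]⟩
            rw [T.res_res, ← hv.2.2.2 n le_rfl (by omega), T.res_self]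
          · refine ⟨q, hq, hv.1, hv.2.1, hv.2.2.1, fun m h1 h2 => ?_⟩
            rw [← hv.2.2.2 m (by omega) h2, ← hq, T.res_res]
        | .inr S, hv =>
          have hp : p.pos ∈ S n := by simpa [T.res_self] using hv.2 n le_rfl (by omega)
          have : ∃ q ∈ S (n + 1), T.res n.le_succ q = p.pos := by
            by_cases hn : Turn true n
            · exact hv.1.some n hn _ hp
            · have hn' : Turn false n := not_turn.1 hn
              obtain ⟨q, hq, hqp⟩ := (p.isQuasi (by omega)).some n hn' _ (hv.1.subset n hp)
              exact ⟨q, hv.1.all n hn' _ hp q hq hqp, hqp⟩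
          obtain ⟨q, hqS, hqp⟩ := this
          refine ⟨q, hqp, hv.1, fun m h1 h2 => ?_⟩
          rcases h1.eq_or_lt with rfl | h1
          · rwa [T.res_self]
          · rw [← T.res_res (Nat.le_of_lt_succ h1) n.le_succ, hqp]
            exact hv.2 m _ h2
      obtain ⟨q, hqp, hqv⟩ := key
      refine ⟨⟨q, fun _ => p.offer (by omega), fun _ => p.answer h, fun _ => p.isQuasi _,
        fun _ => ?_, fun _ => hqv⟩, ?_⟩
      · rw [← T.res_res (show K + 1 ≤ n by omega) n.le_succ, hqp]
        exact hO
      · ext1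
        · exact hqp
        · rfl
        · rfl

/-- The auxiliary game in which player `false` offers a quasi-strategy at time `K` and player `true`
answers it at time `K + 1`. -/
abbrev auxGame (T : GameTree) (W : T.PosSet) (hW : ∀ m n (h : m ≤ n) p, T.res h p ∈ W m → p ∈ W n)
    (K : ℕ) (hK : Turn false K) : GameTree where
  Pos := AuxPos T W K
  res := AuxPos.res
  res_self h p := by
    ext1
    · exact T.res_self h p.pos
    · rfl
    · rfl
  res_res h₁ h₂ p := by
    ext1
    · exact T.res_res h₁ h₂ p.pos
    · rfl
    · rfl
  exists_succ := AuxPos.exists_succ hW hK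

end GameTree

namespace GameTree

variable {T : GameTree} {W : T.PosSet} {K : ℕ}

/-- The offer `A` and the answer `B` are valid at the position `p`, as far as they were made. -/
def ValidData (W : T.PosSet) (K n : ℕ) (p : T.Pos n) (A : T.PosSet)
    (B : (Σ m, T.Pos m) ⊕ T.PosSet) : Prop :=
  (∀ h : K < n, IsQuasi A ∧ T.res h p ∈ A (K + 1)) ∧
    (K + 1 < n → ValidAnswer W K A n p B)

/-- The position of the auxiliary game with underlying position `p`, offer `A` and answer `B`. -/
def AuxPos.ofData {n : ℕ} (p : T.Pos n) (A : T.PosSet) (B : (Σ m, T.Pos m) ⊕ T.PosSet)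
    (h : ValidData W K n p A B) : AuxPos T W K n where
  pos := p
  offer _ := A
  answer _ := B
  isQuasi hn := (h.1 hn).1
  mem_offer hn := (h.1 hn).2
  valid hn := h.2 hn

theorem validData_of_le {n : ℕ} (hn : n ≤ K) (p : T.Pos n) (A : T.PosSet)
    (B : (Σ m, T.Pos m) ⊕ T.PosSet) : ValidData W K n p A B :=
  ⟨fun h => by omega, fun h => by omega⟩

/-- The trivial answer, used where no answer has been made yet. -/
def noAnswer : (Σ m, T.Pos m) ⊕ T.PosSet := .inr fun _ => ∅

/-- Positions of length at most `K` of the auxiliary game. -/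
def AuxPos.base {n : ℕ} (hn : n ≤ K) (p : T.Pos n) : AuxPos T W K n :=
  .ofData p (fun _ => ∅) noAnswer (validData_of_le hn _ _ _)

theorem AuxPos.eq_base {n : ℕ} (hn : n ≤ K) (p : AuxPos T W K n) : p = .base hn p.pos := by
  ext1
  · rfl
  · funext h
    omega
  · funext h
    omega

theorem AuxPos.ofData_congr {n : ℕ} (hn : n ≤ K + 1) (p : T.Pos n) (A : T.PosSet)
    (B B' : (Σ m, T.Pos m) ⊕ T.PosSet) (h : ValidData W K n p A B)
    (h' : ValidData W K n p A B') : AuxPos.ofData p A B h = .ofData p A B' h' := by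
  ext1
  · rfl
  · rfl
  · funext h
    omega

theorem AuxPos.offer_of_res {m n : ℕ} (hmn : m ≤ n) {q : AuxPos T W K n} {p : T.Pos m}
    {A : T.PosSet} {B : (Σ m, T.Pos m) ⊕ T.PosSet} {h : ValidData W K m p A B}
    (hq : q.res hmn = .ofData p A B h) (hK : K < m) (hn : K < n) : q.offer hn = A :=
  congrFun (congrArg AuxPos.offer hq) hK

theorem AuxPos.answer_of_res {m n : ℕ} (hmn : m ≤ n) {q : AuxPos T W K n} {p : T.Pos m}
    {A : T.PosSet} {B : (Σ m, T.Pos m) ⊕ T.PosSet} {h : ValidData W K m p A B}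
    (hq : q.res hmn = .ofData p A B h) (hK : K + 1 < m) (hn : K + 1 < n) : q.answer hn = B :=
  congrFun (congrArg AuxPos.answer hq) hK

open Classical in
/-- Move as prescribed by the rule `f` for the auxiliary game, pretending that the offer is `A` and
the answer is `B`. -/
noncomputable def follow {n : ℕ} (f : AuxPos T W K n → AuxPos T W K (n + 1)) (A : T.PosSet)
    (B : (Σ m, T.Pos m) ⊕ T.PosSet) (p : T.Pos n) : T.Pos (n + 1) :=
  if h : ValidData W K n p A B then (f (.ofData p A B h)).pos else succ n p

theorem follow_eq {n : ℕ} (f : AuxPos T W K n → AuxPos T W K (n + 1)) (A : T.PosSet)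
    (B : (Σ m, T.Pos m) ⊕ T.PosSet) (p : T.Pos n) (h : ValidData W K n p A B) :
    follow f A B p = (f (.ofData p A B h)).pos :=
  dif_pos h

theorem res_follow {n : ℕ} (f : AuxPos T W K n → AuxPos T W K (n + 1))
    (hf : ∀ p, (f p).res n.le_succ = p) (A : T.PosSet) (B : (Σ m, T.Pos m) ⊕ T.PosSet)
    (p : T.Pos n) : T.res n.le_succ (follow f A B p) = p := by
  unfold follow
  split_ifs with h
  · exact congrArg AuxPos.pos (hf (.ofData p A B h))
  · exact res_succ n p

section Offering

/-- The offer made by the rule `f` for time `K` along the position `p`. -/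
def prefixOffer (f : AuxPos T W K K → AuxPos T W K (K + 1)) {n : ℕ} (p : T.Pos n) : T.PosSet :=
  fun m => {q | ∃ h : K ≤ n, q ∈ (f (.base le_rfl (T.res h p))).offer K.lt_succ_self m}

/-- The positions in `W` allowed by the offer. -/
def offerTarget (f : AuxPos T W K K → AuxPos T W K (K + 1)) : T.PosSet :=
  fun m => {u | K + 2 ≤ m ∧ u ∈ prefixOffer f u m ∧ u ∈ W m}

/-- The restriction obtained from the offer `A` by avoiding positions from which player `false` can
force the play into `offerTarget f`. -/
def avoidOffer (f : AuxPos T W K K → AuxPos T W K (K + 1)) (A : T.PosSet) : T.PosSet :=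
  fun m => {q | K + 2 ≤ m ∧ prefixOffer f q = A ∧ q ∈ A m ∧ ¬ Forces false (offerTarget f) m q}

/-- The lifted move of player `false` after time `K`. -/
noncomputable def liftOffering (f : AuxPos T W K K → AuxPos T W K (K + 1)) (n : ℕ)
    (g : AuxPos T W K n → AuxPos T W K (n + 1)) : T.Pos n → T.Pos (n + 1) :=
  splice false (offerTarget f) (K + 1) n
    (fun u p => follow g (prefixOffer f p) (.inl u) p)
    (fun p => follow g (prefixOffer f p)
      (.inr (avoidOffer f (prefixOffer f p))) p)

end Offering

section Answering

/-- The offer `A` is answered by the rule `f` with the position `u`. -/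
def AnswersWith (f : AuxPos T W K (K + 1) → AuxPos T W K (K + 2)) (u : Σ m, T.Pos m)
    (A : T.PosSet) : Prop :=
  ∃ (h : K + 2 ≤ u.1) (hv : ValidData W K (K + 1) (T.res (by omega) u.2) A noAnswer),
    (f (.ofData _ A noAnswer hv)).answer (by omega) = .inl u

/-- The positions that are answers to some offer. -/
def answerTarget (f : AuxPos T W K (K + 1) → AuxPos T W K (K + 2)) : T.PosSet :=
  fun m => {u | ∃ A, AnswersWith f ⟨m, u⟩ A}

open Classical in
/-- An offer that is answered by `u`. -/
noncomputable def offerFor (f : AuxPos T W K (K + 1) → AuxPos T W K (K + 2)) (u : Σ m, T.Pos m) :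
    T.PosSet :=
  if h : ∃ A, AnswersWith f u A then h.choose else fun _ => ∅

theorem offerFor_spec {f : AuxPos T W K (K + 1) → AuxPos T W K (K + 2)} {u : Σ m, T.Pos m}
    (h : ∃ A, AnswersWith f u A) : AnswersWith f u (offerFor f u) := by
  rw [offerFor, dif_pos h]
  exact h.choose_spec

/-- The offer consisting of the positions from which player `true` cannot force an answer. -/
def safeOffer (f : AuxPos T W K (K + 1) → AuxPos T W K (K + 2)) : T.PosSet :=
  fun m => {q | ¬ Forces true (answerTarget f) m q}

open Classical in
/-- The answer of the rule `f` to the safe offer along the position `p`. -/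
noncomputable def safeAnswer (f : AuxPos T W K (K + 1) → AuxPos T W K (K + 2)) {n : ℕ}
    (p : T.Pos n) : (Σ m, T.Pos m) ⊕ T.PosSet :=
  if h : ∃ h : K + 1 ≤ n, ValidData W K (K + 1) (T.res h p) (safeOffer f) noAnswer then
    (f (.ofData _ _ _ h.choose_spec)).answer (by omega) else noAnswer

/-- The lifted move of player `true` after time `K`. -/
noncomputable def liftAnswering (f : AuxPos T W K (K + 1) → AuxPos T W K (K + 2)) (n : ℕ)
    (g : AuxPos T W K n → AuxPos T W K (n + 1)) : T.Pos n → T.Pos (n + 1) :=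
  splice true (answerTarget f) (K + 1) n
    (fun u p => follow g (offerFor f u) (.inl u) p)
    (fun p => follow g (safeOffer f) (safeAnswer f p) p)

end Answering

variable (hW : ∀ m n (h : m ≤ n) p, T.res h p ∈ W m → p ∈ W n) (hK : Turn false K)

open Classical in
/-- The strategy for `T` obtained from a strategy for the auxiliary game. -/
noncomputable def auxLift (j : Bool) (s : (auxGame T W hW K hK).Strategy) : T.Strategy where
  move n p := if h : n ≤ K then AuxPos.pos (s.move n (AuxPos.base h p)) else
    match j with
    | false => liftOffering (s.move K) n (s.move n) p
    | true => liftAnswering (s.move (K + 1)) n (s.move n) p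
  res_move n p := by
    split_ifs with h
    · exact congrArg AuxPos.pos (s.res_move n (AuxPos.base h p))
    · cases j
      · exact res_splice _ _ _ _ _ _ _ (fun u => res_follow _ (s.res_move n) _ _ _)
          (res_follow _ (s.res_move n) _ _ _)
      · exact res_splice _ _ _ _ _ _ _ (fun u => res_follow _ (s.res_move n) _ _ _)
          (res_follow _ (s.res_move n) _ _ _)

/-- The run of the auxiliary game with underlying run `x`, offer `A` and answer `B`. -/
def auxRun (x : T.Run) (A : T.PosSet) (B : (Σ m, T.Pos m) ⊕ T.PosSet)
    (hv : ∀ n, ValidData W K n (x.pos n) A B) : (auxGame T W hW K hK).Run where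
  pos n := AuxPos.ofData (x.pos n) A B (hv n)
  res_pos h := by
    refine AuxPos.ext ?_ rfl rfl
    exact x.res_pos h

variable {hW hK}

theorem auxLift_move_of_le {j : Bool} {s : (auxGame T W hW K hK).Strategy} {n : ℕ} (h : n ≤ K)
    (p : T.Pos n) :
    (auxLift hW hK j s).move n p = AuxPos.pos (s.move n (AuxPos.base h p)) :=
  dif_pos h

theorem auxRun_follows {j : Bool} {s : (auxGame T W hW K hK).Strategy} {x : T.Run}
    (hx : x.Follows j (auxLift hW hK j s) 0)
    {A : T.PosSet} {B : (Σ m, T.Pos m) ⊕ T.PosSet}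
    (hv : ∀ n, ValidData W K n (x.pos n) A B)
    (hpos : ∀ n, K < n → Turn j n →
      x.pos (n + 1) = AuxPos.pos (s.move n (AuxPos.ofData (x.pos n) A B (hv n))))
    (hA : Turn j K → AuxPos.offer (s.move K (AuxPos.base le_rfl (x.pos K))) K.lt_succ_self = A)
    (hB : Turn j (K + 1) → AuxPos.answer
      (s.move (K + 1) (AuxPos.ofData (x.pos (K + 1)) A B (hv _))) (by omega) = B) :
    (auxRun hW hK x A B hv).Follows j s 0 := by
  intro n _ ht
  have hres := s.res_move n (AuxPos.ofData (x.pos n) A B (hv n))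
  refine AuxPos.ext ?_ ?_ ?_
  · by_cases h : n ≤ K
    · change x.pos (n + 1) = AuxPos.pos (s.move n (AuxPos.ofData (x.pos n) A B (hv n)))
      rw [AuxPos.eq_base h (AuxPos.ofData (x.pos n) A B (hv n)), hx n (Nat.zero_le _) ht,
        auxLift_move_of_le h]
      rfl
    · exact hpos n (by omega) ht
  · funext h
    rcases (Nat.lt_succ_iff.1 h).eq_or_lt with rfl | h'
    · refine (hA ht).symm.trans ?_
      have e := AuxPos.eq_base le_rfl (AuxPos.ofData (x.pos K) A B (hv K))
      exact congrArg (fun p => AuxPos.offer (s.move K p) K.lt_succ_self) e.symm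
    · exact (AuxPos.offer_of_res _ hres h' _).symm
  · funext h
    rcases (Nat.lt_succ_iff.1 h).eq_or_lt with rfl | h'
    · exact (hB ht).symm
    · exact (AuxPos.answer_of_res _ hres h' _).symm

end GameTree

namespace GameTree

variable {T : GameTree} {W : T.PosSet} {K : ℕ}

theorem prefixOffer_res (f : AuxPos T W K K → AuxPos T W K (K + 1)) {m n : ℕ} (hm : K ≤ m)
    (h : m ≤ n) (p : T.Pos n) : prefixOffer f (T.res h p) = prefixOffer f p := by
  funext l
  ext q
  simp only [prefixOffer, T.res_res, Set.mem_ofPred_eq]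
  exact ⟨fun ⟨_, h2⟩ => ⟨hm.trans h, h2⟩, fun ⟨_, h2⟩ => ⟨hm, h2⟩⟩

theorem prefixOffer_eq (f : AuxPos T W K K → AuxPos T W K (K + 1)) (p : T.Pos K) :
    prefixOffer f p = (f (.base le_rfl p)).offer K.lt_succ_self := by
  funext l
  ext q
  simp [prefixOffer, T.res_self]

theorem isCounterQuasi_avoidOffer (f : AuxPos T W K K → AuxPos T W K (K + 1)) {A : T.PosSet}
    (hA : IsQuasi A) : IsCounterQuasi W A (avoidOffer f A) where
  subset _ _ h := h.2.2.1
  avoid n p := by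
    rintro ⟨h1, h2, h3, h4⟩ hW
    exact h4 (forces_of_mem ⟨h1, by rwa [h2], hW⟩)
  all n hn p := by
    rintro ⟨h1, h2, h3, h4⟩ q hq hqp
    refine ⟨by omega, ?_, hq, fun h => h4 (forces_of_succ hn q hqp h)⟩
    rw [← h2, ← hqp, prefixOffer_res f (by omega)]
  some n hn p := by
    rintro ⟨h1, h2, h3, h4⟩
    by_contra hcon
    refine h4 (forces_of_forall fun q hqp => ?_)
    by_contra hq
    refine hcon ⟨q, ⟨by omega, ?_, hA.all n hn p h3 q hqp, hq⟩, hqp⟩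
    rw [← h2, ← hqp, prefixOffer_res f (by omega)]

theorem isQuasi_safeOffer (f : AuxPos T W K (K + 1) → AuxPos T W K (K + 2)) :
    IsQuasi (safeOffer f) where
  all _ hn _ hp q hqp := fun h => hp (forces_of_succ hn q hqp h)
  some n _ p hp := by
    by_contra hcon
    refine hp (forces_of_forall fun q hqp => ?_)
    by_contra hq
    exact hcon ⟨q, hq, hqp⟩

theorem safeAnswer_eq (f : AuxPos T W K (K + 1) → AuxPos T W K (K + 2)) {n : ℕ} (h : K + 1 ≤ n)
    {p : T.Pos n} {p' : T.Pos (K + 1)} (e : T.res h p = p')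
    (hv : ValidData W K (K + 1) p' (safeOffer f) noAnswer) :
    safeAnswer f p = (f (.ofData p' _ _ hv)).answer (by omega) := by
  subst e
  exact dif_pos ⟨h, hv⟩

theorem AuxPos.valid_of_res {n : ℕ} {q : AuxPos T W K (n + 1)} {p : T.Pos n} {A : T.PosSet}
    {B : (Σ m, T.Pos m) ⊕ T.PosSet} {h : ValidData W K n p A B}
    (hq : q.res n.le_succ = .ofData p A B h) (hK : K < n) (hB : q.answer (by omega) = B) :
    ValidAnswer W K A (n + 1) q.pos B := by
  have := q.valid (by omega)
  rwa [hB, AuxPos.offer_of_res _ hq hK] at this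

variable {hW : ∀ m n (h : m ≤ n) p, T.res h p ∈ W m → p ∈ W n} {hK : Turn false K}

theorem auxLift_run_false (s : (auxGame T W hW K hK).Strategy) (x : T.Run)
    (hx : x.Follows false (auxLift hW hK false s) 0) :
    ∃ y : (auxGame T W hW K hK).Run, y.Follows false s 0 ∧
      ∀ n, AuxPos.pos (y.pos n) = x.pos n := by
  have hK1 : Turn true (K + 1) := turn_succ.2 (not_turn.2 hK)
  let f : AuxPos T W K K → AuxPos T W K (K + 1) := s.move K
  let q : AuxPos T W K (K + 1) := f (.base le_rfl (x.pos K))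
  set A : T.PosSet := q.offer K.lt_succ_self with hAdef
  have hA : IsQuasi A := q.isQuasi _
  have hAx : ∀ n, K ≤ n → prefixOffer f (x.pos n) = A := fun n hn => by
    rw [← prefixOffer_res f le_rfl hn, x.res_pos, prefixOffer_eq]
  have hmem : x.pos (K + 1) ∈ A (K + 1) := by
    have h := q.mem_offer K.lt_succ_self
    rw [T.res_self] at h
    rwa [hx K (Nat.zero_le _) hK, auxLift_move_of_le le_rfl]
  have hmove : ∀ n, K + 1 ≤ n → Turn false n →
      x.pos (n + 1) = liftOffering f n (s.move n) (x.pos n) := fun n hn ht => by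
    rw [hx n (Nat.zero_le _) ht]
    exact dif_neg (by omega)
  have hne : ∀ n, K < n → Turn false n → K + 1 < n := fun n hn ht => by
    rcases (show K + 1 ≤ n from hn).eq_or_lt with rfl | h
    · exact absurd ht (turn_succ.not.2 (not_not.2 hK))
    · exact h
  have main : ∃ B, ∃ hv : ∀ n, ValidData W K n (x.pos n) A B, ∀ n, K < n → Turn false n →
      x.pos (n + 1) = AuxPos.pos (s.move n (AuxPos.ofData (x.pos n) A B (hv n))) := by
    rcases splice_run (fun m p hp => by have := hp.1; omega) x hmove with
      ⟨m, hm, hmX, h⟩ | ⟨hF, h⟩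
    · have hv : ∀ n, ValidData W K n (x.pos n) A (.inl ⟨m, x.pos m⟩) := fun n => by
        refine ⟨fun _ => ⟨hA, by rwa [x.res_pos]⟩, fun _ => ⟨hmX.1, ?_, hmX.2.2, ?_⟩⟩
        · rw [← hAx m (by omega)]
          exact hmX.2.1
        · intro l h1 h2
          rw [x.res_pos, x.res_pos]
      refine ⟨_, hv, fun n hn ht => ?_⟩
      by_cases hnm : m ≤ n
      · rw [h n hnm ht, hAx n (by omega), follow_eq _ _ _ _ (hv n)]
      · have hres := s.res_move n (AuxPos.ofData (x.pos n) A _ (hv n))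
        have hval := AuxPos.valid_of_res hres hn (AuxPos.answer_of_res _ hres (hne n hn ht) _)
        have := hval.2.2.2 (n + 1) le_rfl (by simp only; omega)
        rw [T.res_self, x.res_pos] at this
        exact this.symm
    · have hS := isCounterQuasi_avoidOffer f hA
      have hxA : ∀ n, K + 2 ≤ n → ∀ m ≤ n, K + 2 ≤ m → x.pos m ∈ A m := by
        intro n hn
        induction n, hn using Nat.le_induction with
        | base =>
          intro m h1 h2
          obtain rfl : m = K + 2 := by omega
          exact hA.all _ hK1 _ hmem _ (x.res_pos _)
        | succ n hn ih =>
          intro m h1 h2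
          rcases h1.eq_or_lt with rfl | h1
          · by_cases ht : Turn true n
            · exact hA.all _ ht _ (ih n le_rfl hn) _ (x.res_pos _)
            · have ht' : Turn false n := not_turn.1 ht
              have hv : ValidData W K n (x.pos n) A (.inr (avoidOffer f A)) := by
                refine ⟨fun _ => ⟨hA, by rwa [x.res_pos]⟩, fun _ => ⟨hS, fun m h1 h2 => ?_⟩⟩
                rw [x.res_pos]
                exact ⟨h2, hAx m (by omega), ih m h1 h2, hF m (by omega)⟩
              have hres := s.res_move n (AuxPos.ofData (x.pos n) A _ hv)
              have hval := AuxPos.valid_of_res hres (by omega)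
                (AuxPos.answer_of_res _ hres (by omega) _)
              have := hval.2 (n + 1) le_rfl (by omega)
              rw [h n (by omega) ht', hAx n (by omega), follow_eq _ _ _ _ hv]
              rw [T.res_self] at this
              exact this.2.2.1
          · exact ih m (by omega) h2
      have hv : ∀ n, ValidData W K n (x.pos n) A (.inr (avoidOffer f A)) := fun n => by
        refine ⟨fun _ => ⟨hA, by rwa [x.res_pos]⟩, fun _ => ⟨hS, fun m h1 h2 => ?_⟩⟩
        rw [x.res_pos]
        exact ⟨h2, hAx m (by omega), hxA m h2 m le_rfl h2, hF m (by omega)⟩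
      refine ⟨_, hv, fun n hn ht => ?_⟩
      rw [h n hn ht, hAx n (by omega), follow_eq _ _ _ _ (hv n)]
  obtain ⟨B, hv, hpos⟩ := main
  exact ⟨auxRun hW hK x A B hv, auxRun_follows hx hv hpos (fun _ => rfl)
    (fun h => absurd hK1 (not_turn (j := true).2 h)), fun _ => rfl⟩

theorem auxLift_run_true (s : (auxGame T W hW K hK).Strategy) (x : T.Run)
    (hx : x.Follows true (auxLift hW hK true s) 0) :
    ∃ y : (auxGame T W hW K hK).Run, y.Follows true s 0 ∧
      ∀ n, AuxPos.pos (y.pos n) = x.pos n := by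
  have hK1 : Turn true (K + 1) := turn_succ.2 (not_turn.2 hK)
  let f : AuxPos T W K (K + 1) → AuxPos T W K (K + 2) := s.move (K + 1)
  have hmove : ∀ n, K + 1 ≤ n → Turn true n →
      x.pos (n + 1) = liftAnswering f n (s.move n) (x.pos n) := fun n hn ht => by
    rw [hx n (Nat.zero_le _) ht]
    exact dif_neg (by omega)
  have main : ∃ A B, ∃ hv : ∀ n, ValidData W K n (x.pos n) A B, (∀ n, K < n → Turn true n →
      x.pos (n + 1) = AuxPos.pos (s.move n (AuxPos.ofData (x.pos n) A B (hv n)))) ∧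
      (f (.ofData (x.pos (K + 1)) A B (hv _))).answer (by omega) = B := by
    rcases splice_run (fun m p hp => by obtain ⟨_, h, _⟩ := hp; simp only at h; omega) x hmove with
      ⟨m, hm, hmX, h⟩ | ⟨hF, h⟩
    · obtain ⟨hm2, hspec⟩ := offerFor_spec hmX
      rw [x.res_pos] at hspec
      obtain ⟨hv0, hans⟩ := hspec
      set A := offerFor f ⟨m, x.pos m⟩
      have hres0 := s.res_move _ (AuxPos.ofData (x.pos (K + 1)) A _ hv0)
      have hval0 : ValidAnswer W K A (K + 2)
          (f (.ofData _ A noAnswer hv0)).pos (.inl ⟨m, x.pos m⟩) := by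
        have := (f (.ofData _ A noAnswer hv0)).valid (by omega)
        rwa [hans, AuxPos.offer_of_res _ hres0 (by omega)] at this
      have hv : ∀ n, ValidData W K n (x.pos n) A (.inl ⟨m, x.pos m⟩) := fun n => by
        refine ⟨fun _ => ⟨(hv0.1 (by omega)).1, ?_⟩,
          fun _ => ⟨hm2, hval0.2.1, hval0.2.2.1, fun l h1 h2 => ?_⟩⟩
        · have := (hv0.1 (by omega)).2
          rw [T.res_self] at this
          rwa [x.res_pos]
        · rw [x.res_pos, x.res_pos]
      have hB : (f (.ofData (x.pos (K + 1)) A _ (hv _))).answer (by omega) =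
          .inl ⟨m, x.pos m⟩ := by
        rw [AuxPos.ofData_congr le_rfl _ _ _ _ (hv _) hv0]
        exact hans
      refine ⟨A, _, hv, fun n hn ht => ?_, hB⟩
      by_cases hnm : m ≤ n
      · rw [h n hnm ht, follow_eq _ _ _ _ (hv n)]
      · have hres := s.res_move n (AuxPos.ofData (x.pos n) A _ (hv n))
        have hans' : AuxPos.answer (s.move n (AuxPos.ofData (x.pos n) A _ (hv n))) (by omega) =
            .inl ⟨m, x.pos m⟩ := by
          rcases (show K + 1 ≤ n from hn).eq_or_lt with rfl | hn
          · exact hB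
          · exact AuxPos.answer_of_res _ hres hn _
        have hval := AuxPos.valid_of_res hres hn hans'
        have := hval.2.2.2 (n + 1) le_rfl (by simp only; omega)
        rw [T.res_self, x.res_pos] at this
        exact this.symm
    · have hA := isQuasi_safeOffer f
      have hxA : ∀ m, K + 1 ≤ m → x.pos m ∈ safeOffer f m := hF
      have hv0 : ValidData W K (K + 1) (x.pos (K + 1)) (safeOffer f) noAnswer :=
        ⟨fun _ => ⟨hA, by rw [x.res_pos]; exact hxA _ le_rfl⟩, fun h => by omega⟩
      set B := (f (.ofData _ _ _ hv0)).answer (by omega) with hBdef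
      have hBx : ∀ n, K + 1 ≤ n → safeAnswer f (x.pos n) = B := fun n hn =>
        safeAnswer_eq f hn (x.res_pos hn) hv0
      have hres0 := s.res_move _ (AuxPos.ofData (x.pos (K + 1)) _ _ hv0)
      have hval0 : ValidAnswer W K (safeOffer f) (K + 2) (f (.ofData _ _ _ hv0)).pos B := by
        have := (f (.ofData _ _ _ hv0)).valid (by omega)
        rwa [← hBdef, AuxPos.offer_of_res _ hres0 (by omega)] at this
      have hp0 : T.res (K + 1).le_succ (f (.ofData _ _ _ hv0)).pos = x.pos (K + 1) :=
        congrArg AuxPos.pos hres0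
      clear_value B
      rcases B with u | S
      · exfalso
        have hu := hval0.1
        refine hval0.2.1 (forces_of_mem ⟨safeOffer f, hu, ?_⟩)
        have e : T.res (show K + 1 ≤ u.1 by omega) u.2 = x.pos (K + 1) := by
          rw [← hval0.2.2.2 (K + 1) (by omega) (by omega), hp0]
        rw [e]
        exact ⟨hv0, hBdef.symm⟩
      · have hS := hval0.1
        have hB : ∀ hv : ValidData W K (K + 1) (x.pos (K + 1)) (safeOffer f) (.inr S),
            (f (.ofData (x.pos (K + 1)) _ _ hv)).answer (by omega) = .inr S := fun hv => by
          rw [AuxPos.ofData_congr le_rfl _ _ _ _ hv hv0]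
          exact hBdef.symm
        have hstep : ∀ n, K + 1 ≤ n → Turn true n → (∀ m ≤ n, K + 2 ≤ m → x.pos m ∈ S m) →
            x.pos (n + 1) ∈ S (n + 1) := by
          intro n hn ht ih
          have hv : ValidData W K n (x.pos n) (safeOffer f) (.inr S) := by
            refine ⟨fun _ => ⟨hA, by rw [x.res_pos]; exact hxA _ le_rfl⟩,
              fun _ => ⟨hS, fun m h1 h2 => ?_⟩⟩
            rw [x.res_pos]
            exact ih m h1 h2
          have hres := s.res_move n (AuxPos.ofData (x.pos n) _ _ hv)
          have hans : AuxPos.answer (s.move n (AuxPos.ofData (x.pos n) _ _ hv)) (by omega) =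
              .inr S := by
            rcases hn.eq_or_lt with rfl | hn
            · exact hB hv
            · exact AuxPos.answer_of_res _ hres hn _
          have hval := AuxPos.valid_of_res hres hn hans
          have := hval.2 (n + 1) le_rfl (by omega)
          rw [T.res_self] at this
          rw [h n hn ht, hBx n hn, follow_eq _ _ _ _ hv]
          exact this
        have hxS : ∀ n, K + 1 ≤ n → ∀ m ≤ n, K + 2 ≤ m → x.pos m ∈ S m := by
          intro n hn
          induction n, hn using Nat.le_induction with
          | base => intro m h1 h2; omega
          | succ n hn ih =>
            intro m h1 h2
            rcases h1.eq_or_lt with rfl | h1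
            · by_cases ht : Turn true n
              · exact hstep n hn ht ih
              · have hn' : K + 2 ≤ n := by
                  rcases hn.eq_or_lt with rfl | hn
                  · exact absurd hK1 ht
                  · exact hn
                exact hS.all n (not_turn.1 ht) _ (ih n le_rfl hn') _ (hxA _ (by omega))
                  (x.res_pos _)
            · exact ih m (by omega) h2
        have hv : ∀ n, ValidData W K n (x.pos n) (safeOffer f) (.inr S) := fun n => by
          refine ⟨fun _ => ⟨hA, by rw [x.res_pos]; exact hxA _ le_rfl⟩,
            fun _ => ⟨hS, fun m h1 h2 => ?_⟩⟩
          rw [x.res_pos]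
          exact hxS m (by omega) m le_rfl h2
        refine ⟨_, _, hv, fun n hn ht => ?_, hB _⟩
        rw [h n hn ht, hBx n hn, follow_eq _ _ _ _ (hv n)]
  obtain ⟨A, B, hv, hpos, hB⟩ := main
  exact ⟨auxRun hW hK x A B hv, auxRun_follows hx hv hpos
    (fun h => absurd hK (not_turn (j := false).2 h)) (fun _ => hB), fun _ => rfl⟩

/-- The unravelling covering. -/
noncomputable def auxCovering (hW : ∀ m n (h : m ≤ n) p, T.res h p ∈ W m → p ∈ W n)
    (hK : Turn false K) {k : ℕ} (hk : k ≤ K) : Covering (auxGame T W hW K hK) T k where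
  map _ := AuxPos.pos
  res_map _ _ := rfl
  lift := auxLift hW hK
  lift_local j s s' n h := by
    funext p
    by_cases hn : n ≤ K
    · rw [auxLift_move_of_le hn, auxLift_move_of_le hn, h n le_rfl]
    · have e (s : (auxGame T W hW K hK).Strategy) : (auxLift hW hK j s).move n p =
        match j with
        | false => liftOffering (s.move K) n (s.move n) p
        | true => liftAnswering (s.move (K + 1)) n (s.move n) p := dif_neg hn
      rw [e, e, h n le_rfl, h K (by omega), h (K + 1) (by omega)]
  lift_run j s x hx := by
    cases j
    · exact auxLift_run_false s x hx
    · exact auxLift_run_true s x hx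
  map_bijective n hn := by
    refine ⟨fun p q h => ?_, fun p => ⟨AuxPos.base (by omega) p, rfl⟩⟩
    rw [AuxPos.eq_base (hn.trans hk) p, AuxPos.eq_base (hn.trans hk) q]
    exact congrArg _ h
  lift_map j s n hn p := by
    have hn' : n ≤ K := by omega
    rw [auxLift_move_of_le hn', ← AuxPos.eq_base hn' p]

/-- Every open set becomes clopen in a suitable covering game. -/
theorem exists_covering_of_isOpenSet {O : Set T.Run} (hO : IsOpenSet O) (k : ℕ) :
    ∃ (S : GameTree) (c : Covering S T k), IsClopenSet (c.mapRun ⁻¹' O) := by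
  let W : T.PosSet := fun n => {p | ∀ x : T.Run, x.pos n = p → x ∈ O}
  have hW : ∀ m n (h : m ≤ n) p, T.res h p ∈ W m → p ∈ W n := fun m n h p hp x hx =>
    hp x (by rw [← hx, x.res_pos])
  have hK : Turn false (2 * k) := by simp [Turn]
  have key : ∀ y : (auxGame T W hW (2 * k) hK).Run,
      (auxCovering hW hK (show k ≤ 2 * k by omega)).mapRun y ∈ O ↔
        (AuxPos.answer (y.pos (2 * k + 2)) (by omega)).isLeft = true := by
    intro y
    set x := (auxCovering hW hK (show k ≤ 2 * k by omega)).mapRun y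
    obtain ⟨B, hB⟩ : ∃ B, B = AuxPos.answer (y.pos (2 * k + 2)) (by omega) := ⟨_, rfl⟩
    rw [← hB]
    have hans : ∀ n (h : 2 * k + 2 ≤ n), AuxPos.answer (y.pos n) (by omega) = B := fun n h => by
      rw [hB]
      rw [← y.res_pos h]
      rfl
    have hval : ∀ n (h : 2 * k + 2 ≤ n), ∃ A, ValidAnswer W (2 * k) A n (x.pos n) B := fun n h => by
      refine ⟨AuxPos.offer (y.pos n) (by omega), ?_⟩
      rw [← hans n h]
      exact AuxPos.valid (y.pos n) _
    rcases B with u | S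
    · refine ⟨fun _ => rfl, fun _ => ?_⟩
      obtain ⟨A, h1, h2, h3, h4⟩ := hval (max u.1 (2 * k + 2)) (le_max_right _ _)
      refine h3 x ?_
      have := h4 u.1 (le_max_left _ _) le_rfl
      rwa [T.res_self, x.res_pos] at this
    · refine ⟨fun hx => ?_, fun h => by simp at h⟩
      exfalso
      obtain ⟨n, hn⟩ := hO x hx
      obtain ⟨A, h1, h2⟩ := hval (max n (2 * k + 2)) (le_max_right _ _)
      have h3 := h2 (max n (2 * k + 2)) le_rfl (le_max_right _ _)
      rw [T.res_self] at h3
      exact h1.avoid _ _ h3 fun z hz => hn z (Run.pos_eq_of_le (le_max_left _ _) hz)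
  refine ⟨_, auxCovering hW hK (show k ≤ 2 * k by omega), ?_, ?_⟩
  · intro y hy
    refine ⟨2 * k + 2, fun z hz => ?_⟩
    rw [Set.mem_preimage, key] at hy ⊢
    rwa [hz]
  · intro y hy
    refine ⟨2 * k + 2, fun z hz => ?_⟩
    rw [Set.mem_compl_iff, Set.mem_preimage, key] at hy ⊢
    rwa [hz]

end GameTree

namespace GameTree

/-- Composition of coverings. -/
def Covering.comp {S T U : GameTree} {k : ℕ} (c : Covering S T k) (d : Covering T U k) :
    Covering S U k where
  map n p := d.map n (c.map n p)
  res_map h p := by rw [d.res_map, c.res_map]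
  lift j s := d.lift j (c.lift j s)
  lift_local j s s' n h := d.lift_local _ _ _ _ fun m hm =>
    c.lift_local _ _ _ _ fun l hl => h l (hl.trans hm)
  lift_run j s x hx := by
    obtain ⟨y, hy, hyx⟩ := d.lift_run j _ x hx
    obtain ⟨z, hz, hzy⟩ := c.lift_run j _ y hy
    exact ⟨z, hz, fun n => by rw [hzy, hyx]⟩
  map_bijective n hn := (d.map_bijective n hn).comp (c.map_bijective n hn)
  lift_map j s n hn p := by rw [d.lift_map _ _ _ hn, c.lift_map _ _ _ hn]

theorem exists_thread {S : ℕ → Type*} (f : ∀ i, S (i + 1) → S i) (i₀ : ℕ)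
    (h : ∀ i, i₀ ≤ i → Function.Surjective (f i)) (a : S i₀) :
    ∃ p : ∀ i, S i, (∀ i, f i (p (i + 1)) = p i) ∧ p i₀ = a := by
  induction i₀ generalizing S with
  | zero =>
    exact ⟨fun i => Nat.rec a (fun i b => (h i (Nat.zero_le _) b).choose) i,
      fun i => (h i (Nat.zero_le _) _).choose_spec, rfl⟩
  | succ i₀ ih =>
    obtain ⟨q, hq, hqa⟩ := ih (S := fun i => S (i + 1)) (fun i => f (i + 1))
      (fun i hi => h _ (by omega)) a
    refine ⟨fun i => Nat.rec (motive := S) (f 0 (q 0)) (fun i _ => q i) i, fun i => ?_, hqa⟩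
    cases i with
    | zero => rfl
    | succ i => exact hq i

theorem thread_unique {S : ℕ → Type*} (f : ∀ i, S (i + 1) → S i) (i₀ : ℕ)
    (h : ∀ i, i₀ ≤ i → Function.Injective (f i)) {p q : ∀ i, S i}
    (hp : ∀ i, f i (p (i + 1)) = p i) (hq : ∀ i, f i (q (i + 1)) = q i) (e : p i₀ = q i₀) :
    p = q := by
  funext i
  have hup : ∀ i, i₀ ≤ i → p i = q i := by
    intro i hi
    induction i, hi using Nat.le_induction with
    | base => exact e
    | succ i hi ih => exact h i hi (by rw [hp, hq, ih])
  have hdown : ∀ d i, p (i + d) = q (i + d) → p i = q i := by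
    intro d
    induction d with
    | zero => exact fun i h => h
    | succ d ih =>
      intro i h
      refine ih i ?_
      rw [← hp, ← hq]
      exact congrArg _ h
  exact hdown i₀ i (hup _ (Nat.le_add_left _ _))

section Limit

variable {T : ℕ → GameTree} {k : ℕ} (c : ∀ i, Covering (T (i + 1)) (T i) (k + i))

/-- Positions of the inverse limit of a sequence of coverings. -/
abbrev LimPos (n : ℕ) : Type :=
  {p : ∀ i, (T i).Pos n // ∀ i, (c i).map n (p (i + 1)) = p i}

theorem LimPos.proj_bijective {n i : ℕ} (h : n ≤ k + i) :
    Function.Bijective fun p : LimPos c n => p.1 i := by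
  have hb : ∀ l, i ≤ l → Function.Bijective ((c l).map n) := fun l hl =>
    (c l).map_bijective n (by omega)
  refine ⟨fun p q e => Subtype.ext ?_, fun a => ?_⟩
  · exact thread_unique (S := fun i => (T i).Pos n) (fun i => (c i).map n) i
      (fun l hl => (hb l hl).1) p.2 q.2 e
  · obtain ⟨p, hp, hpa⟩ := exists_thread (S := fun i => (T i).Pos n) (fun i => (c i).map n) i
      (fun l hl => (hb l hl).2) a
    exact ⟨⟨p, hp⟩, hpa⟩

/-- The inverse limit of a sequence of coverings. -/
abbrev limGame : GameTree where
  Pos := LimPos c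
  res h p := ⟨fun i => (T i).res h (p.1 i), fun i => by rw [← (c i).res_map, p.2]⟩
  res_self h p := Subtype.ext (funext fun i => (T i).res_self h _)
  res_res h₁ h₂ p := Subtype.ext (funext fun i => (T i).res_res h₁ h₂ _)
  exists_succ {n} p := by
    obtain ⟨q, hq⟩ := (T (n + 1)).exists_succ (p.1 (n + 1))
    obtain ⟨r, hr⟩ := (LimPos.proj_bijective c (show n + 1 ≤ k + (n + 1) by omega)).2 q
    refine ⟨r, (LimPos.proj_bijective c (show n ≤ k + (n + 1) by omega)).1 ?_⟩
    simp only at hr ⊢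
    rw [hr, hq]

/-- The projection of runs of the inverse limit. -/
def limProj (i : ℕ) (x : (limGame c).Run) : (T i).Run where
  pos n := (x.pos n).1 i
  res_pos h := by
    rw [← x.res_pos h]

theorem mapRun_limProj (i : ℕ) (x : (limGame c).Run) :
    (c i).mapRun (limProj c (i + 1) x) = limProj c i x :=
  Run.ext (funext fun n => (x.pos n).2 i)

open Classical in
/-- The strategy for the `i`-th game that agrees with `s` as long as the `i`-th game agrees with
the inverse limit. -/
noncomputable def limApprox (s : (limGame c).Strategy) (i : ℕ) : (T i).Strategy where
  move n p := if h : n < k + i then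
    (s.move n ((LimPos.proj_bijective c h.le).2 p).choose).1 i else succ n p
  res_move n p := by
    split_ifs with h
    · refine (congrArg (fun q : LimPos c n => q.1 i) (s.res_move n _)).trans ?_
      exact ((LimPos.proj_bijective c h.le).2 p).choose_spec
    · exact res_succ n p

theorem limApprox_move {s : (limGame c).Strategy} {n i : ℕ} (h : n < k + i) (p : LimPos c n) :
    (limApprox c s i).move n (p.1 i) = (s.move n p).1 i := by
  have hb := LimPos.proj_bijective c h.le
  have e : (hb.2 (p.1 i)).choose = p := hb.1 (hb.2 (p.1 i)).choose_spec
  refine (dif_pos h).trans ?_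
  rw [e]

/-- The strategy for the `i`-th game obtained by lifting the approximation of `s` from the game
with index `i + d`. -/
noncomputable def limIter (j : Bool) (s : (limGame c).Strategy) : ℕ → ∀ i, (T i).Strategy
  | 0, i => limApprox c s i
  | d + 1, i => (c i).lift j (limIter j s d (i + 1))

theorem limIter_succ {j : Bool} {s : (limGame c).Strategy} {n d i : ℕ} (h : n < k + i + d) :
    (limIter c j s (d + 1) i).move n = (limIter c j s d i).move n := by
  induction d generalizing n i with
  | zero =>
    funext p
    obtain ⟨r, rfl⟩ := (LimPos.proj_bijective c (show n ≤ k + i by omega)).2 p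
    simp only [limIter]
    rw [limApprox_move c (by omega), ← r.2 i, (c i).lift_map _ _ _ (by omega),
      limApprox_move c (by omega), (s.move n r).2 i]
  | succ d ih =>
    exact (c i).lift_local _ _ _ _ fun m hm => ih (by omega)

theorem limIter_eq {j : Bool} {s : (limGame c).Strategy} {n d e i : ℕ} (h : n < k + i + d)
    (hde : d ≤ e) : (limIter c j s e i).move n = (limIter c j s d i).move n := by
  induction e, hde using Nat.le_induction with
  | base => rfl
  | succ e he ih => rw [limIter_succ c (by omega), ih]

/-- The strategy for the `i`-th game obtained from a strategy for the inverse limit. -/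
noncomputable def limLift (j : Bool) (s : (limGame c).Strategy) (i : ℕ) : (T i).Strategy where
  move n := (limIter c j s (n + 1) i).move n
  res_move n p := Strategy.res_move _ n p

theorem limLift_eq (j : Bool) (s : (limGame c).Strategy) (i : ℕ) :
    limLift c j s i = (c i).lift j (limLift c j s (i + 1)) := by
  refine Strategy.ext (funext fun n => ?_)
  have e : (c i).lift j (limIter c j s (n + 1) (i + 1)) = limIter c j s (n + 2) i := rfl
  rw [(c i).lift_local j _ (limIter c j s (n + 1) (i + 1)) n, e, limIter_succ c (by omega)]
  · rfl
  · intro m hm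
    exact (limIter_eq c (by omega) (by omega)).symm

theorem limLift_move {j : Bool} {s : (limGame c).Strategy} {n i : ℕ} (h : n < k + i)
    (p : LimPos c n) : (limLift c j s i).move n (p.1 i) = (s.move n p).1 i := by
  rw [← limApprox_move c h]
  exact congrFun (limIter_eq c (d := 0) (by omega) (by omega)) _

theorem limIter_congr {j : Bool} {s s' : (limGame c).Strategy} {n : ℕ}
    (h : ∀ m ≤ n, s.move m = s'.move m) (d i m : ℕ) (hm : m ≤ n) :
    (limIter c j s d i).move m = (limIter c j s' d i).move m := by
  induction d generalizing i m with
  | zero =>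
    funext p
    simp only [limIter, limApprox]
    rw [h m hm]
  | succ d ih => exact (c i).lift_local _ _ _ _ fun l hl => ih _ _ (hl.trans hm)

theorem limLift_run {j : Bool} {s : (limGame c).Strategy} (x : (T 0).Run)
    (hx : x.Follows j (limLift c j s 0) 0) :
    ∃ y : (limGame c).Run, y.Follows j s 0 ∧ ∀ n, (y.pos n).1 0 = x.pos n := by
  have step : ∀ i (z : {z : (T i).Run // z.Follows j (limLift c j s i) 0}),
      ∃ w : {w : (T (i + 1)).Run // w.Follows j (limLift c j s (i + 1)) 0},
        ∀ n, (c i).map n (w.1.pos n) = z.1.pos n := by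
    rintro i ⟨z, hz⟩
    rw [limLift_eq] at hz
    obtain ⟨w, hw, hwz⟩ := (c i).lift_run _ _ _ hz
    exact ⟨⟨w, hw⟩, hwz⟩
  choose g hg using step
  let Y : ∀ i, {z : (T i).Run // z.Follows j (limLift c j s i) 0} :=
    fun i => Nat.rec ⟨x, hx⟩ (fun i z => g i z) i
  refine ⟨⟨fun n => ⟨fun i => (Y i).1.pos n, fun i => hg i (Y i) n⟩, fun h => ?_⟩, ?_,
    fun n => rfl⟩
  · exact Subtype.ext (funext fun i => (Y i).1.res_pos h)
  · intro n _ ht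
    refine (LimPos.proj_bijective c (show n + 1 ≤ k + (n + 1) by omega)).1 ?_
    simp only
    rw [(Y (n + 1)).2 n (Nat.zero_le _) ht, ← limLift_move c (by omega)]

/-- The inverse limit covers the first game. -/
noncomputable def limCovering : Covering (limGame c) (T 0) k where
  map _ p := p.1 0
  res_map _ _ := rfl
  lift j s := limLift c j s 0
  lift_local _ _ _ _ h := limIter_congr c h _ _ _ le_rfl
  lift_run _ _ x hx := limLift_run c x hx
  map_bijective _ hn := LimPos.proj_bijective c hn
  lift_map _ _ _ hn p := limLift_move c hn p

end Limit

theorem IsClopenSet.compl {T : GameTree} {X : Set T.Run} (h : IsClopenSet X) :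
    IsClopenSet Xᶜ := ⟨h.2, by rw [compl_compl]; exact h.1⟩

theorem IsOpenSet.preimage {S T : GameTree} {f : S.Run → T.Run} {g : ∀ n, S.Pos n → T.Pos n}
    (hf : ∀ x n, (f x).pos n = g n (x.pos n)) {X : Set T.Run} (h : IsOpenSet X) :
    IsOpenSet (f ⁻¹' X) := by
  intro x hx
  obtain ⟨n, hn⟩ := h _ hx
  exact ⟨n, fun y hy => hn _ (by rw [hf, hf, hy])⟩

theorem IsClopenSet.preimage {S T : GameTree} {f : S.Run → T.Run} {g : ∀ n, S.Pos n → T.Pos n}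
    (hf : ∀ x n, (f x).pos n = g n (x.pos n)) {X : Set T.Run} (h : IsClopenSet X) :
    IsClopenSet (f ⁻¹' X) := ⟨h.1.preimage hf, h.2.preimage hf⟩

theorem isClopenSet_empty {T : GameTree} : IsClopenSet (∅ : Set T.Run) :=
  ⟨fun _ h => h.elim, fun _ _ => ⟨0, fun _ _ => id⟩⟩

/-- A set `B` is unravelled universally if for every map `h` for which preimages of members of `𝒢`
are clopen, the preimage of `B` becomes clopen in some covering. -/
def Unravels {Z : Type*} (𝒢 : Set (Set Z)) (B : Set Z) : Prop :=
  ∀ (T : GameTree) (h : T.Run → Z), (∀ X ∈ 𝒢, IsClopenSet (h ⁻¹' X)) → ∀ k,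
    ∃ (S : GameTree) (c : Covering S T k), IsClopenSet ((h ∘ c.mapRun) ⁻¹' B)

theorem Unravels.iUnion {Z : Type*} {𝒢 : Set (Set Z)} {B : ℕ → Set Z}
    (hB : ∀ i, Unravels 𝒢 (B i)) : Unravels 𝒢 (⋃ i, B i) := by
  intro T₀ h₀ hh₀ k
  let Stage := {p : Σ T : GameTree, T.Run → Z // ∀ X ∈ 𝒢, IsClopenSet (p.2 ⁻¹' X)}
  have step : ∀ (i : ℕ) (p : Stage), ∃ (q : Stage) (c : Covering q.1.1 p.1.1 (k + i)),
      q.1.2 = p.1.2 ∘ c.mapRun ∧ IsClopenSet (q.1.2 ⁻¹' B i) := by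
    rintro i ⟨⟨T, h⟩, hh⟩
    obtain ⟨S, c, hc⟩ := hB i T h hh (k + i)
    exact ⟨⟨⟨S, h ∘ c.mapRun⟩, fun X hX => (hh X hX).preimage (f := c.mapRun) fun _ _ => rfl⟩,
      c, rfl, hc⟩
  choose next cov hcomp hclopen using step
  let Y : ℕ → Stage := fun i => Nat.rec ⟨⟨T₀, h₀⟩, hh₀⟩ (fun i p => next i p) i
  let U : ℕ → GameTree := fun i => (Y i).1.1
  let c : ∀ i, Covering (U (i + 1)) (U i) (k + i) := fun i => cov i (Y i)
  have hY : ∀ i, (Y (i + 1)).1.2 = (Y i).1.2 ∘ (c i).mapRun := fun i => hcomp i (Y i)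
  let proj : ∀ i, (limGame c).Run → (U i).Run := limProj c
  have hproj : ∀ i x, (Y i).1.2 (proj i x) = (Y 0).1.2 (proj 0 x) := by
    intro i x
    induction i with
    | zero => rfl
    | succ i ih =>
      rw [hY, Function.comp_apply, ← ih]
      exact congrArg _ (mapRun_limProj c i x)
  have hopen : IsOpenSet ((h₀ ∘ (limCovering c).mapRun) ⁻¹' ⋃ i, B i) := by
    rintro x hx
    obtain ⟨i, hi⟩ := Set.mem_iUnion.1 hx
    have hO : IsOpenSet (proj (i + 1) ⁻¹' ((Y (i + 1)).1.2 ⁻¹' B i)) :=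
      (hclopen i (Y i)).1.preimage (f := proj (i + 1)) (g := fun _ p => p.1 (i + 1))
        fun _ _ => rfl
    have hmem : ∀ y, y ∈ proj (i + 1) ⁻¹' ((Y (i + 1)).1.2 ⁻¹' B i) ↔
        (h₀ ∘ (limCovering c).mapRun) y ∈ B i := fun y => iff_of_eq (congrArg (· ∈ B i) (hproj (i + 1) y))
    obtain ⟨n, hn⟩ := hO x ((hmem x).2 hi)
    exact ⟨n, fun y hy => Set.mem_iUnion.2 ⟨i, (hmem y).1 (hn y hy)⟩⟩
  obtain ⟨S, d, hd⟩ := exists_covering_of_isOpenSet hopen k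
  exact ⟨S, d.comp (limCovering c), hd⟩

theorem unravels_of_measurableSet {Z : Type*} {𝒢 : Set (Set Z)} {B : Set Z}
    (hB : @MeasurableSet Z (MeasurableSpace.generateFrom 𝒢) B) : Unravels 𝒢 B := by
  have hclopen : ∀ (T : GameTree) (X : Set T.Run), IsClopenSet X → ∀ k,
      ∃ (S : GameTree) (c : Covering S T k), IsClopenSet (c.mapRun ⁻¹' X) :=
    fun T X hX k => exists_covering_of_isOpenSet hX.1 k
  induction hB with
  | basic X hX => exact fun T h hh k => hclopen T _ (hh X hX) k
  | empty => exact fun T h _ k => hclopen T ∅ isClopenSet_empty k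
  | compl X _ ih =>
    intro T h hh k
    obtain ⟨S, c, hc⟩ := ih T h hh k
    exact ⟨S, c, hc.compl⟩
  | iUnion f _ ih => exact Unravels.iUnion ih

end GameTree

namespace GameTree

/-- Open games with a unique initial position are determined. -/
theorem determined_of_isOpenSet {T : GameTree} [Subsingleton (T.Pos 0)] {X : Set T.Run}
    (hX : IsOpenSet X) :
    (∃ s : T.Strategy, ∀ x : T.Run, x.Follows false s 0 → x ∈ X) ∨
      ∃ s : T.Strategy, ∀ x : T.Run, x.Follows true s 0 → x ∉ X := by
  classical
  let W : T.PosSet := fun n => {p | ∀ x : T.Run, x.pos n = p → x ∈ X}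
  by_cases h : ∃ p, Forces false W 0 p
  · left
    obtain ⟨p, s, hs⟩ := h
    refine ⟨s, fun x hx => ?_⟩
    obtain ⟨m, hm⟩ := hs x (Subsingleton.elim _ _) hx
    exact hm x rfl
  · right
    push Not at h
    refine ⟨⟨fun n p => if hq : ∃ q, T.res n.le_succ q = p ∧ ¬ Forces false W (n + 1) q then
      hq.choose else succ n p, fun n p => ?_⟩, fun x hx hxX => ?_⟩
    · split_ifs with hq
      · exact hq.choose_spec.1
      · exact res_succ n p
    · have hF : ∀ n, ¬ Forces false W n (x.pos n) := by
        intro n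
        induction n with
        | zero => exact h _
        | succ n ih =>
          by_cases ht : Turn false n
          · exact fun hF => ih (forces_of_succ ht _ (x.res_pos _) hF)
          · have hq : ∃ q, T.res n.le_succ q = x.pos n ∧ ¬ Forces false W (n + 1) q := by
              by_contra hcon
              push Not at hcon
              exact ih (forces_of_forall hcon)
            rw [hx n (Nat.zero_le _) (not_turn.1 ht)]
            dsimp only
            rw [dif_pos hq]
            exact hq.choose_spec.2
      obtain ⟨n, hn⟩ := hX x hxX
      exact hF n (forces_of_mem fun y hy => hn y hy)

/-- Borel determinacy for games with a unique initial position. -/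
theorem determined_of_measurableSet {T : GameTree} [Subsingleton (T.Pos 0)] {Z : Type*}
    {𝒢 : Set (Set Z)} (h : T.Run → Z) (hh : ∀ X ∈ 𝒢, IsClopenSet (h ⁻¹' X)) {B : Set Z}
    (hB : @MeasurableSet Z (MeasurableSpace.generateFrom 𝒢) B) :
    (∃ s : T.Strategy, ∀ x : T.Run, x.Follows false s 0 → h x ∈ B) ∨
      ∃ s : T.Strategy, ∀ x : T.Run, x.Follows true s 0 → h x ∉ B := by
  obtain ⟨S, c, hc⟩ := unravels_of_measurableSet hB T h hh 0
  have : Subsingleton (S.Pos 0) := (c.map_bijective 0 le_rfl).1.subsingleton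
  have key : ∀ j (s : S.Strategy) (x : T.Run), x.Follows j (c.lift j s) 0 →
      ∃ y : S.Run, y.Follows j s 0 ∧ c.mapRun y = x := fun j s x hx => by
    obtain ⟨y, hy, hyx⟩ := c.lift_run j s x hx
    exact ⟨y, hy, Run.ext (funext hyx)⟩
  rcases determined_of_isOpenSet hc.1 with ⟨s, hs⟩ | ⟨s, hs⟩
  · refine .inl ⟨c.lift false s, fun x hx => ?_⟩
    obtain ⟨y, hy, rfl⟩ := key _ _ _ hx
    exact hs y hy
  · refine .inr ⟨c.lift true s, fun x hx => ?_⟩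
    obtain ⟨y, hy, rfl⟩ := key _ _ _ hx
    exact hs y hy

/-- The game in which the players alternately choose elements of `α`. -/
abbrev seqGame (α : Type) [Nonempty α] : GameTree where
  Pos n := Fin n → α
  res h p i := p (Fin.castLE h i)
  res_self _ _ := rfl
  res_res _ _ _ := rfl
  exists_succ {n} p := by
    refine ⟨Fin.snoc p (Classical.arbitrary α), funext fun i => ?_⟩
    exact Fin.snoc_castSucc (α := fun _ => α) _ p i

/-- Borel determinacy for sequences of elements of `α`, where player `j` uses a rule `σ` giving
moves depending on the previous moves. -/
theorem determined_seq {α : Type} [Nonempty α] [MeasurableSpace α] {V : Set (ℕ → α)}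
    (hV : MeasurableSet V) :
    (∃ σ : ∀ n, (Fin n → α) → α, ∀ ρ : ℕ → α,
      (∀ n, Turn false n → ρ n = σ n fun i => ρ i) → ρ ∈ V) ∨
    ∃ σ : ∀ n, (Fin n → α) → α, ∀ ρ : ℕ → α,
      (∀ n, Turn true n → ρ n = σ n fun i => ρ i) → ρ ∉ V := by
  let 𝒢 : Set (Set (ℕ → α)) := {X | ∃ (n : ℕ) (C : Set α), X = {ρ | ρ n ∈ C}}
  let h : (seqGame α).Run → ℕ → α := fun x n => x.pos (n + 1) (Fin.last n)
  have hB : @MeasurableSet _ (MeasurableSpace.generateFrom 𝒢) V := by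
    refine (iSup_le fun n => ?_ : MeasurableSpace.pi ≤ MeasurableSpace.generateFrom 𝒢) V hV
    rintro _ ⟨C, -, rfl⟩
    exact MeasurableSpace.measurableSet_generateFrom ⟨n, C, rfl⟩
  have hh : ∀ X ∈ 𝒢, IsClopenSet (h ⁻¹' X) := by
    rintro _ ⟨n, C, rfl⟩
    constructor
    · intro x hx
      refine ⟨n + 1, fun y hy => ?_⟩
      change y.pos (n + 1) (Fin.last n) ∈ C
      rw [hy]
      exact hx
    · intro x hx
      refine ⟨n + 1, fun y hy => ?_⟩
      change y.pos (n + 1) (Fin.last n) ∉ C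
      rw [hy]
      exact hx
  have key : ∀ (j : Bool) (s : (seqGame α).Strategy) (ρ : ℕ → α),
      (∀ n, Turn j n → ρ n = s.move n (fun i => ρ i) (Fin.last n)) →
      ∃ x : (seqGame α).Run, x.Follows j s 0 ∧ h x = ρ := by
    intro j s ρ hρ
    refine ⟨⟨fun n i => ρ i, fun _ => rfl⟩, fun n _ ht => funext fun i => ?_, rfl⟩
    induction i using Fin.lastCases with
    | last => exact hρ n ht
    | cast i => exact (congrFun (s.res_move n fun i => ρ i) i).symm
  rcases determined_of_measurableSet h hh hB with ⟨s, hs⟩ | ⟨s, hs⟩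
  · refine .inl ⟨fun n p => s.move n p (Fin.last n), fun ρ hρ => ?_⟩
    obtain ⟨x, hx, rfl⟩ := key false s ρ hρ
    exact hs x hx
  · refine .inr ⟨fun n p => s.move n p (Fin.last n), fun ρ hρ => ?_⟩
    obtain ⟨x, hx, rfl⟩ := key true s ρ hρ
    exact hs x hx

end GameTree

open GameTree (Turn)

/-- The combinatorial data carried by a free product `G` of two groups `M false` and `M true`:
the inclusions of the factors, the leading letter of a reduced word in either factor, and a
numbering of the elements such that nontrivial words with leading letter in `M b` have numbers
of parity `b`, and removing the leading letter decreases the number. -/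
structure Alternation (G : Type) [Group G] (M : Bool → Type) [∀ b, Group (M b)] where
  /-- The inclusions of the factors. -/
  incl : ∀ b, M b →* G
  /-- The leading letter in the factor `M b`, or `1` if there is none. -/
  head : ∀ b, G → M b
  head_mul : ∀ b γ α, head b (incl b γ * α) = γ * head b α
  head_one : ∀ b, head b 1 = 1
  /-- The numbering. -/
  num : G → ℕ
  num_injective : Function.Injective num
  head_ne_one : ∀ b α, α ≠ 1 → (head b α ≠ 1 ↔ Turn b (num α))
  num_tail : ∀ b α, head b α ≠ 1 → num ((incl b (head b α))⁻¹ * α) < num α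

/-- The family consisting of two groups. -/
def Factor (Γ Δ : Type) (b : Bool) : Type := cond b Δ Γ

instance (Γ Δ : Type) [Group Γ] [Group Δ] : ∀ b, Group (Factor Γ Δ b)
  | false => inferInstanceAs (Group Γ)
  | true => inferInstanceAs (Group Δ)

instance (Γ Δ : Type) [Countable Γ] [Countable Δ] : ∀ b, Countable (Factor Γ Δ b)
  | false => inferInstanceAs (Countable Γ)
  | true => inferInstanceAs (Countable Δ)

/-- The inclusion of a factor into the binary free product. -/
def factorIncl (Γ Δ : Type) [Group Γ] [Group Δ] : ∀ b, Factor Γ Δ b →* Monoid.Coprod Γ Δ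
  | false => Monoid.Coprod.inl
  | true => Monoid.Coprod.inr

/-- The binary free product as an indexed free product. -/
def coprodEquiv (Γ Δ : Type) [Group Γ] [Group Δ] :
    Monoid.Coprod Γ Δ ≃* Monoid.CoprodI (Factor Γ Δ) :=
  MonoidHom.toMulEquiv
    (Monoid.Coprod.lift (Monoid.CoprodI.of (M := Factor Γ Δ) (i := false))
      (Monoid.CoprodI.of (M := Factor Γ Δ) (i := true)))
    (Monoid.CoprodI.lift (factorIncl Γ Δ))
    (Monoid.Coprod.hom_ext
      (MonoidHom.ext fun x =>
        Monoid.CoprodI.lift_of (M := Factor Γ Δ) (i := false) (factorIncl Γ Δ) x)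
      (MonoidHom.ext fun x =>
        Monoid.CoprodI.lift_of (M := Factor Γ Δ) (i := true) (factorIncl Γ Δ) x))
    (Monoid.CoprodI.ext_hom _ _ fun b => MonoidHom.ext fun x => by
      simp only [MonoidHom.comp_apply, Monoid.CoprodI.lift_of]
      cases b
      · exact Monoid.Coprod.lift_apply_inl _ _ _
      · exact Monoid.Coprod.lift_apply_inr _ _ _)

theorem coprodEquiv_factorIncl (Γ Δ : Type) [Group Γ] [Group Δ] (b : Bool) (x : Factor Γ Δ b) :
    coprodEquiv Γ Δ (factorIncl Γ Δ b x) = Monoid.CoprodI.of x := by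
  cases b
  · exact Monoid.Coprod.lift_apply_inl (Monoid.CoprodI.of (M := Factor Γ Δ) (i := false))
      (Monoid.CoprodI.of (M := Factor Γ Δ) (i := true)) x
  · exact Monoid.Coprod.lift_apply_inr (Monoid.CoprodI.of (M := Factor Γ Δ) (i := false))
      (Monoid.CoprodI.of (M := Factor Γ Δ) (i := true)) x

namespace Alternation

/-- A numbering of the lists of letters. -/
def listNum {M : Bool → Type} (enc : ∀ b, M b → ℕ) : List (Σ b, M b) → ℕ
  | [] => 0
  | ⟨b, m⟩ :: l => 2 * Nat.pair (enc b m) (listNum enc l) + (cond b 1 2)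

theorem listNum_injective {M : Bool → Type} {enc : ∀ b, M b → ℕ}
    (h : ∀ b, Function.Injective (enc b)) : Function.Injective (listNum enc) := by
  intro l
  induction l with
  | nil =>
    rintro (_ | ⟨⟨b, m⟩, l'⟩) e
    · rfl
    · cases b <;> simp [listNum] at e
  | cons x l ih =>
    obtain ⟨b, m⟩ := x
    rintro (_ | ⟨⟨b', m'⟩, l'⟩) e
    · cases b <;> simp [listNum] at e
    · cases b <;> cases b' <;> simp only [listNum, cond_true, cond_false] at e
      · obtain ⟨e1, e2⟩ := Nat.pair_eq_pair.1 (by omega :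
          Nat.pair (enc false m) (listNum enc l) = Nat.pair (enc false m') (listNum enc l'))
        rw [h _ e1, ih e2]
      · omega
      · omega
      · obtain ⟨e1, e2⟩ := Nat.pair_eq_pair.1 (by omega :
          Nat.pair (enc true m) (listNum enc l) = Nat.pair (enc true m') (listNum enc l'))
        rw [h _ e1, ih e2]

theorem listNum_lt {M : Bool → Type} (enc : ∀ b, M b → ℕ) (b : Bool) (m : M b)
    (l : List (Σ b, M b)) : listNum enc l < listNum enc (⟨b, m⟩ :: l) := by
  have := Nat.right_le_pair (enc b m) (listNum enc l)
  cases b <;> simp only [listNum, cond_true, cond_false] <;> omega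

theorem turn_listNum {M : Bool → Type} (enc : ∀ b, M b → ℕ) (b c : Bool) (m : M b)
    (l : List (Σ b, M b)) : Turn c (listNum enc (⟨b, m⟩ :: l)) ↔ b = c := by
  cases b <;> cases c <;> simp [listNum, Turn]

open scoped Classical in
/-- The alternation of a binary free product of countable groups. -/
theorem exists_coprod (Γ Δ : Type) [Group Γ] [Group Δ] [Countable Γ] [Countable Δ] :
    ∃ a : Alternation (Monoid.Coprod Γ Δ) (Factor Γ Δ), a.incl = factorIncl Γ Δ := by
  choose enc henc using fun b : Bool => exists_injective_nat (Factor Γ Δ b)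
  let W : Monoid.Coprod Γ Δ → Monoid.CoprodI.Word (Factor Γ Δ) := fun α =>
    Monoid.CoprodI.Word.equiv (coprodEquiv Γ Δ α)
  have hW : Function.Injective W :=
    Monoid.CoprodI.Word.equiv.injective.comp (coprodEquiv Γ Δ).injective
  have hW1 : W 1 = .empty := by
    change coprodEquiv Γ Δ 1 • Monoid.CoprodI.Word.empty = _
    rw [map_one, one_smul]
  have hWmul : ∀ b γ α, W (factorIncl Γ Δ b γ * α) = Monoid.CoprodI.of γ • W α := by
    intro b γ α
    change coprodEquiv Γ Δ _ • (.empty : Monoid.CoprodI.Word (Factor Γ Δ)) =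
      Monoid.CoprodI.of γ • coprodEquiv Γ Δ α • (.empty : Monoid.CoprodI.Word (Factor Γ Δ))
    rw [map_mul, coprodEquiv_factorIncl, mul_smul]
  have hWinv : ∀ b γ α, W ((factorIncl Γ Δ b γ)⁻¹ * α) = (Monoid.CoprodI.of γ)⁻¹ • W α := by
    intro b γ α
    rw [← map_inv, hWmul, map_inv]
  have hcons : ∀ w : Monoid.CoprodI.Word (Factor Γ Δ), w ≠ .empty → ∃ b, ∃ m : Factor Γ Δ b,
      ∃ w' h1 h2, w = .cons m w' h1 h2 := by
    intro w
    refine Monoid.CoprodI.Word.consRecOn w (fun h => (h rfl).elim) ?_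
    intro b m w' h1 h2 _ _
    exact ⟨b, m, w', h1, h2, rfl⟩
  have hpair : ∀ c b (m : Factor Γ Δ b) w' h1 h2,
      (Monoid.CoprodI.Word.equivPair c (.cons m w' h1 h2)).head ≠ 1 ↔ b = c := by
    intro c b m w' h1 h2
    by_cases hb : b = c
    · subst hb
      rw [Monoid.CoprodI.Word.cons_eq_smul, Monoid.CoprodI.Word.equivPair_smul_same,
        Monoid.CoprodI.Word.equivPair_eq_of_fstIdx_ne h1]
      simpa using h2
    · rw [Monoid.CoprodI.Word.equivPair_eq_of_fstIdx_ne]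
      · simpa using hb
      · simpa using hb
  refine ⟨{
    incl := factorIncl Γ Δ
    head := fun b α => (Monoid.CoprodI.Word.equivPair b (W α)).head
    head_mul := fun b γ α => by
      rw [hWmul, Monoid.CoprodI.Word.equivPair_smul_same]
    head_one := fun b => by
      rw [hW1, Monoid.CoprodI.Word.equivPair_eq_of_fstIdx_ne]
      simp [Monoid.CoprodI.Word.fstIdx]
    num := fun α => listNum enc (W α).toList
    num_injective := fun α β h => hW (Monoid.CoprodI.Word.ext (listNum_injective henc h))
    head_ne_one := fun b α hα => by
      obtain ⟨c, m, w', h1, h2, e⟩ := hcons (W α) (fun h => hα (hW (h.trans hW1.symm)))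
      rw [e, hpair]
      exact (turn_listNum enc c b m w'.toList).symm
    num_tail := fun b α h => by
      rw [hWinv, ← Monoid.CoprodI.Word.equivPair_tail_eq_inv_smul]
      obtain ⟨c, m, w', h1, h2, e⟩ := hcons (W α) (fun h' => h (by
        rw [h', Monoid.CoprodI.Word.equivPair_eq_of_fstIdx_ne]
        simp [Monoid.CoprodI.Word.fstIdx]))
      rw [e, hpair] at h
      subst h
      have : (Monoid.CoprodI.Word.equivPair c (W α)).tail = w' := by
        rw [e, Monoid.CoprodI.Word.cons_eq_smul, Monoid.CoprodI.Word.equivPair_smul_same,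
          Monoid.CoprodI.Word.equivPair_eq_of_fstIdx_ne h1]
      rw [this, e]
      exact listNum_lt enc c m w'.toList }, rfl⟩

end Alternation

namespace Alternation

variable {G : Type} [Group G] {M : Bool → Type} [∀ b, Group (M b)] (a : Alternation G M)

/-- The result of removing the leading letter in `M b`, if any. -/
def tail (b : Bool) (α : G) : G := (a.incl b (a.head b α))⁻¹ * α

theorem head_tail (b : Bool) (α : G) : a.head b (a.tail b α) = 1 := by
  rw [tail, ← map_inv, a.head_mul, inv_mul_cancel]

theorem incl_head_mul_tail (b : Bool) (α : G) : a.incl b (a.head b α) * a.tail b α = α := by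
  rw [tail, mul_inv_cancel_left]

theorem tail_incl_mul (b : Bool) (γ : M b) (α : G) :
    a.tail b (a.incl b γ * α) = a.tail b α := by
  rw [tail, a.head_mul, tail]
  simp [mul_assoc]

theorem tail_of_head_eq_one {b : Bool} {α : G} (h : a.head b α = 1) : a.tail b α = α := by
  rw [tail, h, map_one, inv_one, one_mul]

theorem num_tail_lt {b : Bool} {α : G} {t : ℕ} (h : a.head b α ≠ 1 ∧ a.num α = t) :
    a.num (a.tail b α) < t :=
  (a.num_tail b α h.1).trans_eq h.2

variable {K : Type}

open scoped Classical in
/-- The point of the shift space with value `c` at the identity and whose other values are read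
off from `ρ` along the numbering. -/
noncomputable def decode (c : K) (ρ : ℕ → K) : G → K :=
  fun α => if α = 1 then c else ρ (a.num α)

theorem measurable_decode [MeasurableSpace K] (c : K) : Measurable (a.decode c) := by
  refine measurable_pi_lambda _ fun α => ?_
  unfold decode
  split_ifs
  · exact measurable_const
  · exact measurable_pi_apply _

open scoped Classical in
/-- The simultaneous runs, indexed by `γ : M b`, in which the strategies `σ (x γ)` choose the
moves of parity `!b` and the moves of parity `b` are copied from the other runs. -/
noncomputable def simRun (b : Bool) {N : ℕ} (e : Fin N → K)
    (σ : Fin N → ∀ t, (Fin t → K) → K) (x : M b → Fin N) (t : ℕ) (γ : M b) : K :=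
  if Turn (!b) t then σ (x γ) t fun s => simRun b e σ x s γ
  else if h : ∃ α, a.head b α ≠ 1 ∧ a.num α = t then
    if a.tail b h.choose = 1 then e (x (γ * a.head b h.choose))
    else simRun b e σ x (a.num (a.tail b h.choose)) (γ * a.head b h.choose)
  else e (x γ)
termination_by t
decreasing_by
  · exact s.2
  · exact a.num_tail_lt h.choose_spec

section

variable (b : Bool) {N : ℕ} (e : Fin N → K) (σ : Fin N → ∀ t, (Fin t → K) → K)

theorem simRun_of_turn (x : M b → Fin N) (γ : M b) {t : ℕ} (ht : Turn (!b) t) :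
    a.simRun b e σ x t γ = σ (x γ) t fun s => a.simRun b e σ x s γ := by
  rw [simRun, if_pos ht]

/-- The points of the shift space described by the simultaneous runs. -/
noncomputable def simPoint (x : M b → Fin N) (γ : M b) : G → K :=
  a.decode (e (x γ)) fun t => a.simRun b e σ x t γ

theorem simPoint_eq_tail (x : M b → Fin N) (γ : M b) (α : G) :
    a.simPoint b e σ x γ α = a.simPoint b e σ x (γ * a.head b α) (a.tail b α) := by
  by_cases h : a.head b α = 1
  · rw [h, mul_one, a.tail_of_head_eq_one h]
  have h1 : α ≠ 1 := fun h1 => h (h1 ▸ a.head_one b)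
  have ht : ¬Turn (!b) (a.num α) := by
    rw [← GameTree.not_turn, not_not]
    exact (a.head_ne_one b α h1).1 h
  have hex : ∃ β, a.head b β ≠ 1 ∧ a.num β = a.num α := ⟨α, h, rfl⟩
  have hch : hex.choose = α := a.num_injective hex.choose_spec.2
  unfold simPoint decode
  rw [if_neg h1]
  beta_reduce
  rw [simRun, if_neg ht, dif_pos hex, hch]

theorem simPoint_incl_mul (x : M b → Fin N) (γ γ' : M b) (α : G) :
    a.simPoint b e σ x γ (a.incl b γ' * α) = a.simPoint b e σ x (γ * γ') α := by
  rw [simPoint_eq_tail, a.head_mul, a.tail_incl_mul, ← mul_assoc, ← simPoint_eq_tail]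

theorem simPoint_one (x : M b → Fin N) (γ : M b) : a.simPoint b e σ x γ 1 = e (x γ) :=
  if_pos rfl

theorem simRun_shift (x : M b → Fin N) (γ₀ : M b) (t : ℕ) (γ : M b) :
    a.simRun b e σ (shift γ₀ x) t γ = a.simRun b e σ x t (γ₀⁻¹ * γ) := by
  induction t using Nat.strong_induction_on generalizing γ with
  | _ t ih =>
    rw [simRun, simRun]
    split_ifs with h1 h2 h3
    · congr 1
      funext s
      exact ih s s.2 γ
    · simp [shift, mul_assoc]
    · rw [ih _ (a.num_tail_lt h2.choose_spec), mul_assoc]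
    · rfl

theorem simPoint_shift (x : M b → Fin N) (γ₀ γ : M b) :
    a.simPoint b e σ (shift γ₀ x) γ = a.simPoint b e σ x (γ₀⁻¹ * γ) := by
  unfold simPoint
  simp only [simRun_shift]
  rfl

end

theorem measurable_simRun (b : Bool) {N k : ℕ} (e : Fin N → Fin k)
    (σ : Fin N → ∀ t, (Fin t → Fin k) → Fin k) (t : ℕ) (γ : M b) :
    Measurable fun x => a.simRun b e σ x t γ := by
  induction t using Nat.strong_induction_on generalizing γ with
  | _ t ih =>
    have he : ∀ γ, Measurable fun x : M b → Fin N => e (x γ) := fun γ =>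
      (measurable_of_countable e).comp (measurable_pi_apply γ)
    unfold simRun
    split_ifs with h1 h2 h3
    · exact (measurable_of_countable fun p : Fin N × (Fin t → Fin k) => σ p.1 t p.2).comp
        ((measurable_pi_apply γ).prodMk (measurable_pi_lambda _ fun s : Fin t => ih s s.2 γ))
    · exact he _
    · exact ih _ (a.num_tail_lt h2.choose_spec) _
    · exact he _

/-- If, for each of `N` colors of the identity, there is a strategy for the moves of parity `!b`
that forces the described point into `V`, then there is an injective equivariant map from the
shift space with `N` colors over `M b` all of whose values have their `M b`-orbit in `V`. -/
theorem exists_equivariant (b : Bool) {N k : ℕ} {V : Set (G → Fin k)} (e : Fin N ↪ Fin k)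
    (he : ∀ c, ∃ σ : ∀ t, (Fin t → Fin k) → Fin k, ∀ ρ : ℕ → Fin k,
      (∀ t, Turn (!b) t → ρ t = σ t fun i => ρ i) → a.decode (e c) ρ ∈ V) :
    ∃ f : (M b → Fin N) → (G → Fin k), Measurable f ∧
      (∀ γ x, f (shift γ x) = shift (a.incl b γ) (f x)) ∧
      (∀ x γ, f x (a.incl b γ) = e (x γ)) ∧ ∀ x γ, shift (a.incl b γ) (f x) ∈ V := by
  choose σ hσ using he
  have hsh : ∀ x γ, shift (a.incl b γ) (a.simPoint b e σ x 1) = a.simPoint b e σ x γ⁻¹ := by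
    intro x γ
    funext α
    change a.simPoint b e σ x 1 ((a.incl b γ)⁻¹ * α) = _
    rw [← map_inv, simPoint_incl_mul, one_mul]
  refine ⟨fun x => a.simPoint b e σ x 1, ?_, ?_, ?_, ?_⟩
  · have : Measurable fun x : M b → Fin N => e (x 1) :=
      (measurable_of_countable e).comp (measurable_pi_apply 1)
    refine measurable_pi_lambda _ fun α => ?_
    unfold simPoint decode
    split_ifs
    · exact this
    · exact a.measurable_simRun b e σ _ _
  · intro γ x
    beta_reduce
    rw [hsh, simPoint_shift, mul_one]
  · intro x γ
    have := a.simPoint_incl_mul b e σ x 1 γ 1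
    rwa [mul_one, one_mul, simPoint_one] at this
  · intro x γ
    rw [hsh]
    exact hσ _ _ fun t ht => a.simRun_of_turn b e σ x _ ht

end Alternation

/-- If every class of two equivalence relations meeting the finite set `F` contains at least two
points of `F`, then the classes can choose points of `F` without conflicts. -/
theorem exists_disjoint_transversals {Z : Type*} (r : Bool → Setoid Z) (F : Finset Z)
    (hF : ∀ x ∈ F, ∀ b, ∃ y ∈ F, y ≠ x ∧ r b x y) :
    ∃ T : Bool → Finset Z, (∀ b, T b ⊆ F) ∧ Disjoint (T false) (T true) ∧
      ∀ b, ∀ x ∈ F, ∃ y ∈ T b, r b x y := by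
  classical
  let ι := {v : Σ b, Quotient (r b) // ∃ p ∈ F, Quotient.mk (r v.1) p = v.2}
  let t : ι → Finset Z := fun v => F.filter fun p => Quotient.mk (r v.1.1) p = v.1.2
  obtain ⟨f, hf, hft⟩ := (Finset.all_card_le_biUnion_card_iff_exists_injective t).1 (by
    intro s
    have := Finset.card_mul_le_card_mul (s := s) (t := s.biUnion t) (m := 2) (n := 2)
      (fun v p => p ∈ t v) ?_ ?_
    · omega
    · rintro ⟨⟨b, q⟩, x, hx, hq⟩ hv
      change Quotient.mk (r b) x = q at hq
      subst hq
      obtain ⟨y, hy, hne, hxy⟩ := hF x hx b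
      refine (Finset.card_pair hne).symm.trans_le (Finset.card_le_card ?_)
      have hxt : x ∈ t ⟨⟨b, Quotient.mk (r b) x⟩, x, hx, rfl⟩ := Finset.mem_filter.2 ⟨hx, rfl⟩
      have hyt : y ∈ t ⟨⟨b, Quotient.mk (r b) x⟩, x, hx, rfl⟩ :=
        Finset.mem_filter.2 ⟨hy, Quotient.sound ((r b).symm hxy)⟩
      intro z hz
      rcases Finset.mem_insert.1 hz with rfl | hz
      · exact Finset.mem_filter.2 ⟨Finset.mem_biUnion.2 ⟨_, hv, hyt⟩, hyt⟩
      · obtain rfl := Finset.mem_singleton.1 hz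
        exact Finset.mem_filter.2 ⟨Finset.mem_biUnion.2 ⟨_, hv, hxt⟩, hxt⟩
    · intro p _
      have : (Finset.univ : Finset Bool).card = 2 := rfl
      rw [← this]
      refine Finset.card_le_card_of_injOn (fun v => v.1.1)
        (fun _ _ => Finset.mem_coe.2 (Finset.mem_univ _)) ?_
      rintro ⟨⟨b, q⟩, hv⟩ h ⟨⟨b', q'⟩, hv'⟩ h' (rfl : b = b')
      have e := (Finset.mem_filter.1 (Finset.mem_filter.1 h).2).2
      have e' := (Finset.mem_filter.1 (Finset.mem_filter.1 h').2).2
      exact Subtype.ext (congrArg (Sigma.mk b) (e.symm.trans e')))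
  let T : Bool → Finset Z := fun b => F.filter fun p => ∃ v : ι, v.1.1 = b ∧ f v = p
  refine ⟨T, fun b => Finset.filter_subset _ _, ?_, ?_⟩
  · rw [Finset.disjoint_left]
    intro p h h'
    obtain ⟨v, hv, rfl⟩ := (Finset.mem_filter.1 h).2
    obtain ⟨v', hv', e⟩ := (Finset.mem_filter.1 h').2
    rw [hf e, hv] at hv'
    cases hv'
  · intro b x hx
    obtain ⟨h1, h2⟩ := Finset.mem_filter.1 (hft ⟨⟨b, Quotient.mk (r b) x⟩, x, hx, rfl⟩)
    exact ⟨_, Finset.mem_filter.2 ⟨h1, _, rfl, rfl⟩, (r b).symm (Quotient.exact h2)⟩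

/-- The points of a closed path, whose steps alternate between two equivalence relations, contain
a nonempty finite set in which each point has a partner with respect to both relations. -/
theorem exists_finset_of_closed {Z : Type*} (r : Bool → Setoid Z) (X : Set Z) (l : ℕ) (b : Bool)
    (p : ℕ → Z) (hX : ∀ i, p i ∈ X) (hl : 0 < l) (h0 : p 0 = p l)
    (hp : ∀ i < l, p i ≠ p (i + 1) ∧ r (b ^^ i.bodd) (p i) (p (i + 1))) :
    ∃ F : Finset Z, F.Nonempty ∧ ↑F ⊆ X ∧ ∀ x ∈ F, ∀ b, ∃ y ∈ F, y ≠ x ∧ r b x y := by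
  classical
  induction l using Nat.strong_induction_on generalizing b p with
  | _ l ih =>
    cases hpar : l.bodd with
    | false =>
      refine ⟨(Finset.range l).image p, ⟨p 0, Finset.mem_image.2 ⟨0, by simpa, rfl⟩⟩, ?_, ?_⟩
      · intro x hx
        obtain ⟨i, -, rfl⟩ := Finset.mem_image.1 (Finset.mem_coe.1 hx)
        exact hX i
      · intro x hx c
        obtain ⟨i, hi, rfl⟩ := Finset.mem_image.1 hx
        rw [Finset.mem_range] at hi
        have hmem : ∀ j ≤ l, p j ∈ (Finset.range l).image p := by
          intro j hj
          rcases hj.lt_or_eq with hj | rfl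
          · exact Finset.mem_image_of_mem p (Finset.mem_range.2 hj)
          · rw [← h0]
            exact Finset.mem_image_of_mem p (Finset.mem_range.2 hl)
        by_cases hc : c = (b ^^ i.bodd)
        · subst hc
          exact ⟨p (i + 1), hmem _ hi, (hp i hi).1.symm, (hp i hi).2⟩
        · obtain ⟨j, hj, hij, hb⟩ : ∃ j < l, p (j + 1) = p i ∧ j.bodd = !i.bodd := by
            cases i with
            | zero =>
              refine ⟨l - 1, by omega, ?_, ?_⟩
              · rw [Nat.sub_add_cancel hl, h0]
              · obtain ⟨k, rfl⟩ := Nat.exists_eq_succ_of_ne_zero hl.ne'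
                simpa using hpar
            | succ i => exact ⟨i, by omega, rfl, by simp⟩
          refine ⟨p j, hmem j hj.le, ?_, ?_⟩
          · rw [← hij]
            exact (hp j hj).1
          · have hc' : c = (b ^^ j.bodd) := by
              rw [hb]
              revert hc
              cases c <;> cases b <;> cases i.bodd <;> simp
            rw [← hij, hc']
            exact (r _).symm (hp j hj).2
    | true =>
      have hl1 : l ≠ 1 := by
        rintro rfl
        exact (hp 0 hl).1 h0
      have hl2 : l ≠ 2 := by
        rintro rfl
        simp at hpar
      have hlast := hp (l - 1) (by omega)
      have hpar' : (l - 1).bodd = false := by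
        obtain ⟨k, rfl⟩ := Nat.exists_eq_succ_of_ne_zero hl.ne'
        simpa using hpar
      rw [Nat.sub_add_cancel hl, ← h0, hpar'] at hlast
      have hfirst := hp 0 hl
      have hbodd : ∀ i : ℕ, ((!b) ^^ i.bodd) = (b ^^ (i + 1).bodd) := by
        intro i
        cases b <;> simp
      by_cases heq : p (l - 1) = p 1
      · refine ih (l - 2) (by omega) (!b) (fun i => p (i + 1)) (fun i => hX _) (by omega) ?_ ?_
        · rw [← heq]
          congr 1
          omega
        · intro i hi
          rw [hbodd]
          exact hp (i + 1) (by omega)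
      · refine ih (l - 1) (by omega) (!b) (fun i => if i = l - 1 then p 1 else p (i + 1)) ?_
          (by omega) ?_ ?_
        · intro i
          split_ifs <;> exact hX _
        · simp
        · intro i hi
          rw [hbodd, if_neg hi.ne]
          split_ifs with h
          · rw [h, hpar', Bool.xor_false]
            rw [Nat.bodd_zero] at hfirst
            rw [Bool.xor_false] at hlast hfirst
            exact ⟨heq, (r b).trans hlast.2 hfirst.2⟩
          · exact hp (i + 1) (by omega)

namespace Alternation

variable {G : Type} [Group G] {M : Bool → Type} [∀ b, Group (M b)] (a : Alternation G M)

section Cycle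

variable {Z : Type} [MulAction G Z]

/-- The orbit equivalence relation of a factor. -/
def factorRel (Z : Type) [MulAction G Z] (b : Bool) : Setoid Z where
  r p q := ∃ γ : M b, a.incl b γ • p = q
  iseqv := {
    refl := fun p => ⟨1, by rw [map_one, one_smul]⟩
    symm := by
      rintro p _ ⟨γ, rfl⟩
      exact ⟨γ⁻¹, by rw [map_inv, inv_smul_smul]⟩
    trans := by
      rintro p _ _ ⟨γ, rfl⟩ ⟨γ', rfl⟩
      exact ⟨γ' * γ, by rw [map_mul, mul_smul]⟩ }

theorem head_not_ne_one {b : Bool} {g : G} (hg : g ≠ 1) (h : a.head b g = 1) :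
    a.head (!b) g ≠ 1 := by
  rw [a.head_ne_one _ _ hg, ← GameTree.not_turn, ← a.head_ne_one _ _ hg, not_not]
  exact h

theorem exists_path (z : Z)
    (hz : ∀ b (γ : M b), ∀ x ∈ MulAction.orbit G z, γ ≠ 1 → a.incl b γ • x ≠ x) (g : G) (b : Bool)
    (hg : a.head b g ≠ 1) :
    ∃ l > 0, ∃ p : ℕ → Z, (∀ i, p i ∈ MulAction.orbit G z) ∧ p 0 = g • z ∧ p l = z ∧
      ∀ i < l, p i ≠ p (i + 1) ∧ a.factorRel Z (b ^^ i.bodd) (p i) (p (i + 1)) := by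
  induction hn : a.num g using Nat.strong_induction_on generalizing g b with
  | _ n ih =>
    have hstep : g • z ≠ a.tail b g • z ∧ a.factorRel Z b (g • z) (a.tail b g • z) := by
      have : g • z = a.incl b (a.head b g) • a.tail b g • z := by
        rw [← mul_smul, a.incl_head_mul_tail]
      rw [this]
      exact ⟨hz b _ _ (MulAction.mem_orbit _ _) hg, (a.factorRel Z b).symm ⟨_, rfl⟩⟩
    by_cases ht : a.tail b g = 1
    · refine ⟨1, one_pos, fun i => if i = 0 then g • z else z, ?_, if_pos rfl, if_neg one_ne_zero,
        ?_⟩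
      · intro i
        beta_reduce
        split_ifs
        · exact MulAction.mem_orbit _ _
        · exact MulAction.mem_orbit_self _
      · intro i hi
        obtain rfl := Nat.lt_one_iff.1 hi
        rw [ht, one_smul] at hstep
        rw [Nat.bodd_zero, Bool.xor_false]
        simpa using hstep
    · obtain ⟨l, hl, p, h1, h2, h3, h4⟩ := ih _ (a.num_tail_lt ⟨hg, hn⟩) (a.tail b g) (!b)
        (a.head_not_ne_one ht (a.head_tail b g)) rfl
      refine ⟨l + 1, Nat.succ_pos l, fun i => Nat.casesOn i (g • z) p, ?_, rfl, h3, ?_⟩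
      · rintro (_ | i)
        · exact MulAction.mem_orbit _ _
        · exact h1 i
      · rintro (_ | i) hi
        · change g • z ≠ p 0 ∧ _
          rw [Nat.bodd_zero, Bool.xor_false, Nat.zero_add]
          change _ ∧ a.factorRel Z b (g • z) (p 0)
          rw [h2]
          exact hstep
        · have := h4 i (by omega)
          rw [Nat.bodd_succ, Bool.xor_not, ← Bool.not_xor]
          exact this

theorem exists_cycle (z : Z)
    (hz : ∀ b (γ : M b), ∀ x ∈ MulAction.orbit G z, γ ≠ 1 → a.incl b γ • x ≠ x)
    (hfree : ∃ g : G, g ≠ 1 ∧ g • z = z) :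
    ∃ T : Bool → Finset G, (∀ b, (T b).Nonempty) ∧
      (∀ s ∈ T false, ∀ t ∈ T true, s • z ≠ t • z) ∧
      ∀ b, ∀ s ∈ T (!b), ∃ γ : M b, ∃ t ∈ T b, a.incl b γ • s • z = t • z := by
  classical
  obtain ⟨g, hg, hgz⟩ := hfree
  obtain ⟨b, hb⟩ : ∃ b, a.head b g ≠ 1 := by
    by_cases h : a.head false g = 1
    · exact ⟨_, a.head_not_ne_one hg h⟩
    · exact ⟨_, h⟩
  obtain ⟨l, hl, p, h1, h2, h3, h4⟩ := a.exists_path z hz g b hb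
  obtain ⟨F, hF, hFX, hF2⟩ := exists_finset_of_closed (a.factorRel Z) (MulAction.orbit G z) l b p
    h1 hl (by rw [h2, h3, hgz]) h4
  obtain ⟨T, hTF, hTd, hT⟩ := exists_disjoint_transversals (a.factorRel Z) F hF2
  have hc : ∀ x : Z, ∃ g : G, x ∈ F → g • z = x := by
    intro x
    by_cases hx : x ∈ F
    · obtain ⟨g, hg⟩ := hFX hx
      exact ⟨g, fun _ => hg⟩
    · exact ⟨1, fun h => (hx h).elim⟩
  choose c hc using hc
  refine ⟨fun b => (T b).image c, ?_, ?_, ?_⟩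
  · intro b
    obtain ⟨x, hx⟩ := hF
    obtain ⟨y, hy, -⟩ := hT b x hx
    exact ⟨_, Finset.mem_image_of_mem c hy⟩
  · intro s hs t ht
    obtain ⟨x, hx, rfl⟩ := Finset.mem_image.1 hs
    obtain ⟨y, hy, rfl⟩ := Finset.mem_image.1 ht
    rw [hc x (hTF _ hx), hc y (hTF _ hy)]
    rintro rfl
    exact Finset.disjoint_left.1 hTd hx hy
  · intro b s hs
    obtain ⟨x, hx, rfl⟩ := Finset.mem_image.1 hs
    obtain ⟨y, hy, γ, hγ⟩ := hT b x (hTF _ hx)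
    refine ⟨γ, c y, Finset.mem_image_of_mem c hy, ?_⟩
    rw [hc x (hTF _ hx), hc y (hTF _ hy), hγ]

end Cycle

end Alternation

open TopologicalSpace (countableBasis)

namespace Alternation

variable {G : Type} [Group G] {M : Bool → Type} [∀ b, Group (M b)] (a : Alternation G M)
  {Z : Type} [MulAction G Z]

/-- Points from which the elements of `T false` and of `T true` describe a closed alternating path
that can be recognized by means of the set `U`. -/
def cyclePoints (Z : Type) [MulAction G Z] (T : Bool → Finset G) (U : Set Z) : Set Z :=
  {z | z ∈ U ∧ (∀ b, (T b).Nonempty) ∧ (∀ s ∈ T false, ∀ t ∈ T true, (t⁻¹ * s) • z ∉ U) ∧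
    ∀ b, ∀ s ∈ T (!b), ∃ γ : M b, ∃ t ∈ T b, a.incl b γ • s • z = t • z}

/-- Points at distance at most `n` from the sets `S false` and `S true`, or from points whose
stabilizer in a factor is nontrivial. -/
def near (S : Bool → Set Z) : ℕ → Bool → Set Z
  | 0, b => {p | (∃ γ : M b, γ ≠ 1 ∧ a.incl b γ • p = p) ∨ ∃ γ : M b, a.incl b γ • p ∈ S b}
  | n + 1, b => {p | ∃ γ : M b, ∃ c, a.incl b γ • p ∈ near S n c}

theorem mem_near_of_incl_smul {S : Bool → Set Z} {n : ℕ} {b : Bool} {γ : M b} {p : Z}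
    (h : a.incl b γ • p ∈ a.near S n b) : p ∈ a.near S n b := by
  cases n with
  | zero =>
    rcases h with ⟨γ', h1, h2⟩ | ⟨γ', h⟩
    · refine .inl ⟨γ⁻¹ * γ' * γ, ?_, ?_⟩
      · intro h
        apply h1
        rw [mul_eq_one_iff_eq_inv, mul_eq_left] at h
        exact h
      · rw [map_mul, map_mul, mul_smul, mul_smul, h2, map_inv, inv_smul_smul]
    · exact .inr ⟨γ' * γ, by rwa [map_mul, mul_smul]⟩
  | succ n =>
    obtain ⟨γ', c, h⟩ := h
    exact ⟨γ' * γ, c, by rwa [map_mul, mul_smul]⟩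

theorem near_succ (S : Bool → Set Z) (n : ℕ) (b c : Bool) :
    a.near S n c ⊆ a.near S (n + 1) b := fun p hp =>
  ⟨1, c, by rwa [map_one, one_smul]⟩

theorem near_mono (S : Bool → Set Z) (b : Bool) : Monotone fun n => a.near S n b :=
  monotone_nat_of_le_succ fun n => a.near_succ S n b b

/-- The points assigned to the orbits of the factor `M b`. -/
def assigned (S : Bool → Set Z) (b : Bool) : Set Z :=
  S b ∪ ⋃ n, a.near S n (!b) \ a.near S n b

theorem exists_mem_assigned (S : Bool → Set Z) {b : Bool} {y : Z} (h : ∃ n, y ∈ a.near S n b)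
    (hy : ∀ γ : M b, a.incl b γ • y = y → γ = 1) : ∃ γ : M b, a.incl b γ • y ∈ a.assigned S b := by
  classical
  have hmin := fun m => Nat.find_min (m := m) h
  have hspec := Nat.find_spec h
  generalize Nat.find h = n at hmin hspec
  cases n with
  | zero =>
    rcases hspec with ⟨γ, h1, h2⟩ | ⟨γ, h⟩
    · exact (h1 (hy γ h2)).elim
    · exact ⟨γ, .inl h⟩
  | succ n =>
    obtain ⟨γ, c, hc⟩ := hspec
    have hn : a.incl b γ • y ∉ a.near S n b := fun h =>
      hmin n n.lt_succ_self (a.mem_near_of_incl_smul h)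
    have hcb : c = !b := by
      by_contra hcb
      rw [Bool.not_eq_not.1 hcb] at hc
      exact hn hc
    subst hcb
    exact ⟨γ, .inr (Set.mem_iUnion.2 ⟨n, hc, hn⟩)⟩

theorem disjoint_assigned {S : Bool → Set Z} (hd : Disjoint (S false) (S true))
    (hS : ∀ b, S (!b) ⊆ a.near S 0 b) : Disjoint (a.assigned S false) (a.assigned S true) := by
  have h0 : ∀ b, S b ⊆ a.near S 0 (!b) := fun b p hp => hS (!b) (by rwa [Bool.not_not])
  rw [Set.disjoint_left] at hd ⊢
  rintro p (h | h) (h' | h')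
  · exact hd h h'
  · obtain ⟨n, h1, h2⟩ := Set.mem_iUnion.1 h'
    exact h2 (a.near_mono S _ (Nat.zero_le n) (h0 false h))
  · obtain ⟨n, h1, h2⟩ := Set.mem_iUnion.1 h
    exact h2 (a.near_mono S _ (Nat.zero_le n) (h0 true h'))
  · obtain ⟨n, h1, h2⟩ := Set.mem_iUnion.1 h
    obtain ⟨n', h1', h2'⟩ := Set.mem_iUnion.1 h'
    rcases le_total n n' with hn | hn
    · exact h2' (a.near_mono S _ hn h1)
    · exact h2 (a.near_mono S _ hn h1')

theorem exists_mem_near (S : Bool → Set Z) {y : Z} (h : ∃ g : G, ∃ n c, g • y ∈ a.near S n c)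
    (b : Bool) : ∃ n, y ∈ a.near S n b := by
  suffices ∃ n c, y ∈ a.near S n c by
    obtain ⟨n, c, h⟩ := this
    exact ⟨n + 1, a.near_succ S n b c h⟩
  obtain ⟨g, n, c, h⟩ := h
  induction hn : a.num g using Nat.strong_induction_on generalizing g n c with
  | _ k ih =>
    by_cases hg : g = 1
    · subst hg
      rw [one_smul] at h
      exact ⟨n, c, h⟩
    obtain ⟨b, hb⟩ : ∃ b, a.head b g ≠ 1 := by
      by_cases h : a.head false g = 1
      · exact ⟨_, a.head_not_ne_one hg h⟩
      · exact ⟨_, h⟩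
    refine ih _ (a.num_tail_lt ⟨hb, hn⟩) (a.tail b g) (n + 1) b ⟨a.head b g, c, ?_⟩ rfl
    rwa [← mul_smul, a.incl_head_mul_tail]

section Measurable

variable [MeasurableSpace Z] [MeasurableConstSMul G Z] [∀ b, Countable (M b)]

theorem measurableSet_near [MeasurableEq Z] {S : Bool → Set Z} (hS : ∀ b, MeasurableSet (S b))
    (n : ℕ) (b : Bool) : MeasurableSet (a.near S n b) := by
  induction n generalizing b with
  | zero =>
    have : a.near S 0 b = (⋃ γ : M b, {p | γ ≠ 1 ∧ a.incl b γ • p = p}) ∪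
        ⋃ γ : M b, (fun p => a.incl b γ • p) ⁻¹' S b := by
      ext p
      simp [near]
    rw [this]
    refine (MeasurableSet.iUnion fun γ => ?_).union (.iUnion fun γ => ?_)
    · exact (MeasurableSet.const _).inter
        (measurableSet_eq_fun (measurable_const_smul _) measurable_id)
    · exact measurable_const_smul _ (hS b)
  | succ n ih =>
    have : a.near S (n + 1) b = ⋃ γ : M b, ⋃ c, (fun p => a.incl b γ • p) ⁻¹' a.near S n c := by
      ext p
      simp [near]
    rw [this]
    exact .iUnion fun γ => .iUnion fun c => measurable_const_smul _ (ih c)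

theorem measurableSet_assigned [MeasurableEq Z] {S : Bool → Set Z}
    (hS : ∀ b, MeasurableSet (S b)) (b : Bool) : MeasurableSet (a.assigned S b) :=
  (hS b).union (.iUnion fun n => (a.measurableSet_near hS n _).diff (a.measurableSet_near hS n _))

theorem measurableSet_cyclePoints [MeasurableEq Z] (T : Bool → Finset G) {U : Set Z}
    (hU : MeasurableSet U) : MeasurableSet (a.cyclePoints Z T U) := by
  refine hU.inter ((MeasurableSet.const _).inter (.inter ?_ ?_))
  · have : {z : Z | ∀ s ∈ T false, ∀ t ∈ T true, (t⁻¹ * s) • z ∉ U} =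
        ⋂ s ∈ T false, ⋂ t ∈ T true, ((fun z => (t⁻¹ * s) • z) ⁻¹' U)ᶜ := by
      ext z
      simp
    change MeasurableSet {z : Z | ∀ s ∈ T false, ∀ t ∈ T true, (t⁻¹ * s) • z ∉ U}
    rw [this]
    exact Finset.measurableSet_biInter _ fun s _ => Finset.measurableSet_biInter _ fun t _ =>
      (measurable_const_smul _ hU).compl
  · have : {z : Z | ∀ b, ∀ s ∈ T (!b), ∃ γ : M b, ∃ t ∈ T b, a.incl b γ • s • z = t • z} =
        ⋂ b, ⋂ s ∈ T (!b), ⋃ γ : M b, ⋃ t ∈ T b, {z | a.incl b γ • s • z = t • z} := by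
      ext z
      simp
    change MeasurableSet
      {z : Z | ∀ b, ∀ s ∈ T (!b), ∃ γ : M b, ∃ t ∈ T b, a.incl b γ • s • z = t • z}
    rw [this]
    exact .iInter fun b => Finset.measurableSet_biInter _ fun s _ => .iUnion fun γ =>
      Finset.measurableSet_biUnion _ fun t _ => measurableSet_eq_fun
        ((measurable_const_smul _).comp (measurable_const_smul _)) (measurable_const_smul _)

end Measurable

/-- Disjoint sets that select a closed alternating path from every orbit which has a closed
alternating path and on which both factors act freely. -/
theorem exists_cycle_selection [Countable G] [∀ b, Countable (M b)] [TopologicalSpace Z]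
    [T2Space Z] [SecondCountableTopology Z] [MeasurableSpace Z] [BorelSpace Z]
    [MeasurableConstSMul G Z] :
    ∃ S : Bool → Set Z, (∀ b, MeasurableSet (S b)) ∧ Disjoint (S false) (S true) ∧
      (∀ b, S (!b) ⊆ a.near S 0 b) ∧
      ∀ y : Z, (∃ g : G, g ≠ 1 ∧ g • y = y) → ∃ g : G, ∃ b, g • y ∈ a.near S 0 b := by
  classical
  obtain ⟨code, hcode⟩ := exists_injective_nat ((Bool → Finset G) × countableBasis Z)
  let C : (Bool → Finset G) × countableBasis Z → Set Z := fun c => a.cyclePoints Z c.1 c.2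
  have hC : ∀ c, MeasurableSet (C c) := fun c => a.measurableSet_cyclePoints c.1
    (TopologicalSpace.isOpen_of_mem_countableBasis c.2.2).measurableSet
  let C₀ : (Bool → Finset G) × countableBasis Z → Set Z := fun c =>
    C c ∩ ⋂ (c') (_ : code c' < code c) (g : G), ((fun z => g • z) ⁻¹' C c')ᶜ
  have hC₀ : ∀ c, MeasurableSet (C₀ c) := fun c => (hC c).inter <| .iInter fun c' => .iInter
    fun _ => .iInter fun g => (measurable_const_smul g (hC c')).compl
  have hmem₀ : ∀ c z, z ∈ C₀ c ↔ z ∈ C c ∧ ∀ c', code c' < code c → ∀ g : G, g • z ∉ C c' := by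
    intro c z
    simp [C₀]
  let S : Bool → Set Z := fun b => ⋃ (c) (t ∈ c.1 b), (fun z => (t : G)⁻¹ • z) ⁻¹' C₀ c
  have hS : ∀ b p, p ∈ S b ↔ ∃ c, ∃ t ∈ c.1 b, ∃ z ∈ C₀ c, p = t • z := by
    intro b p
    simp only [S, Set.mem_iUnion, Set.mem_preimage, exists_prop]
    refine exists_congr fun c => exists_congr fun t => and_congr_right fun _ => ?_
    constructor
    · intro h
      exact ⟨_, h, (smul_inv_smul t p).symm⟩
    · rintro ⟨z, hz, rfl⟩
      rwa [inv_smul_smul]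
  refine ⟨S, ?_, ?_, ?_, ?_⟩
  · exact fun b => .iUnion fun c => Finset.measurableSet_biUnion _ fun t _ =>
      measurable_const_smul _ (hC₀ c)
  · rw [Set.disjoint_left]
    intro p h h'
    obtain ⟨c, s, hs, z, hz, rfl⟩ := (hS _ _).1 h
    obtain ⟨c', t, ht, z', hz', e⟩ := (hS _ _).1 h'
    rw [hmem₀] at hz hz'
    have e1 : z' = (t⁻¹ * s) • z := by rw [mul_smul, e, inv_smul_smul]
    have e2 : z = (s⁻¹ * t) • z' := by rw [mul_smul, ← e, inv_smul_smul]
    have hcc : c = c' := by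
      apply hcode
      apply le_antisymm
      · by_contra! hlt
        exact hz.2 c' hlt _ (e1 ▸ hz'.1)
      · by_contra! hlt
        exact hz'.2 c hlt _ (e2 ▸ hz.1)
    subst hcc
    exact hz.1.2.2.1 s hs t ht (e1 ▸ hz'.1.1)
  · intro b p hp
    obtain ⟨c, s, hs, z, hz, rfl⟩ := (hS _ _).1 hp
    obtain ⟨γ, t, ht, e⟩ := ((hmem₀ _ _).1 hz).1.2.2.2 b s hs
    exact Or.inr ⟨γ, (hS _ _).2 ⟨c, t, ht, z, hz, e⟩⟩
  · intro y hy
    by_cases hell : ∃ b, ∃ γ : M b, ∃ x ∈ MulAction.orbit G y, γ ≠ 1 ∧ a.incl b γ • x = x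
    · obtain ⟨b, γ, _, ⟨g, rfl⟩, h1, h2⟩ := hell
      exact ⟨g, b, Or.inl ⟨γ, h1, h2⟩⟩
    push Not at hell
    obtain ⟨T, hT1, hT2, hT3⟩ := a.exists_cycle y hell hy
    have hex : ∃ n, ∃ c, code c = n ∧ ∃ g : G, g • y ∈ C c := by
      let E : Finset Z := (T false ×ˢ T true).image fun q => (q.2⁻¹ * q.1) • y
      have hyE : y ∈ ((E : Set Z)ᶜ) := by
        intro h
        obtain ⟨⟨s, t⟩, hst, e⟩ := Finset.mem_image.1 (Finset.mem_coe.1 h)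
        obtain ⟨hs, ht⟩ := Finset.mem_product.1 hst
        refine hT2 s hs t ht ?_
        rw [mul_smul, inv_smul_eq_iff] at e
        exact e
      obtain ⟨U, hU, hyU, hUE⟩ := (TopologicalSpace.isBasis_countableBasis Z)
        |>.exists_subset_of_mem_open hyE E.finite_toSet.isClosed.isOpen_compl
      refine ⟨_, (T, ⟨U, hU⟩), rfl, 1, ?_⟩
      rw [one_smul]
      refine ⟨hyU, hT1, fun s hs t ht h => hUE h ?_, hT3⟩
      exact Finset.mem_coe.2 (Finset.mem_image.2 ⟨(s, t), Finset.mem_product.2 ⟨hs, ht⟩, rfl⟩)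
    obtain ⟨c, hc, g, hg⟩ := Nat.find_spec hex
    have hg₀ : g • y ∈ C₀ c := by
      refine (hmem₀ _ _).2 ⟨hg, fun c' hc' g' h => Nat.find_min hex (hc ▸ hc') ⟨c', rfl, g' * g, ?_⟩⟩
      rwa [mul_smul]
    obtain ⟨t, ht⟩ := hg.2.1 false
    refine ⟨t * g, false, Or.inr ⟨1, ?_⟩⟩
    rw [map_one, one_smul, mul_smul]
    exact (hS _ _).2 ⟨c, t, ht, _, hg₀, rfl⟩

/-- A Borel set such that orbits of non-free points under the factor `M false`, on which that
factor acts freely, meet the set, whereas such orbits under `M true` meet its complement. -/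
theorem exists_separator [Countable G] [∀ b, Countable (M b)] [TopologicalSpace Z]
    [T2Space Z] [SecondCountableTopology Z] [MeasurableSpace Z] [BorelSpace Z]
    [MeasurableConstSMul G Z] :
    ∃ D : Set Z, MeasurableSet D ∧ ∀ y : Z, (∃ g : G, g ≠ 1 ∧ g • y = y) →
      ((∀ γ : M false, a.incl false γ • y = y → γ = 1) →
        ∃ γ : M false, a.incl false γ • y ∈ D) ∧
      ((∀ γ : M true, a.incl true γ • y = y → γ = 1) →
        ∃ γ : M true, a.incl true γ • y ∉ D) := by
  obtain ⟨S, hS, hd, h0, h⟩ := a.exists_cycle_selection (Z := Z)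
  refine ⟨a.assigned S false, a.measurableSet_assigned hS false, fun y hy => ?_⟩
  obtain ⟨g, c, hg⟩ := h y hy
  have hnear := a.exists_mem_near S ⟨g, 0, c, hg⟩
  refine ⟨a.exists_mem_assigned S (hnear false), fun hfree => ?_⟩
  obtain ⟨γ, hγ⟩ := a.exists_mem_assigned S (hnear true) hfree
  exact ⟨γ, Set.disjoint_right.1 (a.disjoint_assigned hd h0) hγ⟩

end Alternation

/-- The left shift action. -/
@[reducible] def shiftAction (G X : Type) [Group G] : MulAction G (G → X) where
  smul := shift
  one_smul y := funext fun β => congrArg y (by rw [inv_one, one_mul])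
  mul_smul γ γ' y := funext fun β => congrArg y (by rw [mul_inv_rev, mul_assoc])

theorem measurable_shift {G X : Type} [Group G] [MeasurableSpace X] (γ : G) :
    Measurable (shift γ : (G → X) → G → X) :=
  measurable_pi_lambda _ fun _ => measurable_pi_apply _

theorem measurableSet_freePart (G : Type) [Group G] [Countable G] (k : ℕ) :
    MeasurableSet (freePart G (Fin k)) := by
  have : freePart G (Fin k) = ⋂ (γ : G) (_ : γ ≠ 1), {y | shift γ y = y}ᶜ := by
    ext y
    simp [freePart]
  rw [this]
  exact .iInter fun γ => .iInter fun _ =>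
    (measurableSet_eq_fun (measurable_shift γ) measurable_id).compl

theorem mem_freePart_of_shift {G X : Type} [Group G] {γ : G} {y : G → X}
    (h : shift γ y ∈ freePart G X) : y ∈ freePart G X := by
  let := shiftAction G X
  intro g hg e
  refine h (γ * g * γ⁻¹) (fun h1 => hg ?_) ?_
  · rwa [mul_inv_eq_one, mul_eq_left] at h1
  · change g • y = y at e
    change (γ * g * γ⁻¹) • γ • y = γ • y
    rw [mul_smul, mul_smul, inv_smul_smul, e]

namespace Alternation

variable {G : Type} [Group G] {M : Bool → Type} [∀ b, Group (M b)] (a : Alternation G M)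

/-- Winning strategies for `N` colors of the identity yield an equivariant Borel injection of free
parts, provided that `M b`-orbits contained in `V` on which `M b` acts freely lie in `A`. -/
theorem exists_freePart_map (b : Bool) {N k : ℕ} {V A : Set (G → Fin k)} {P : Fin k → Prop}
    (hP : ∀ c, P c → ∃ σ : ∀ t, (Fin t → Fin k) → Fin k, ∀ ρ : ℕ → Fin k,
      (∀ t, Turn (!b) t → ρ t = σ t fun i => ρ i) → a.decode c ρ ∈ V)
    (hN : N ≤ Nat.card {c // P c})
    (hV : ∀ y : G → Fin k, (∀ γ : M b, shift (a.incl b γ) y = y → γ = 1) →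
      (∀ γ : M b, shift (a.incl b γ) y ∈ V) → y ∈ freePart G (Fin k) ∧ y ∈ A) :
    ∃ f : freePart (M b) (Fin N) → freePart G (Fin k),
      Function.Injective f ∧ Measurable f ∧
      (∀ (γ : M b) (x y : freePart (M b) (Fin N)), (y : M b → Fin N) = shift γ (x : M b → Fin N) →
        (f y : G → Fin k) = shift (a.incl b γ) (f x : G → Fin k)) ∧
      ∀ x, (f x : G → Fin k) ∈ A := by
  obtain ⟨e⟩ : Nonempty (Fin N ↪ {c // P c}) :=
    ⟨(Fin.castLEEmb hN).trans (Finite.equivFin _).symm.toEmbedding⟩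
  obtain ⟨f, hf, hequi, hval, hmem⟩ := a.exists_equivariant b (V := V)
    (e.trans (Function.Embedding.subtype P)) fun c => hP _ (e c).2
  have hinj : Function.Injective f := by
    intro x y hxy
    funext γ
    have := congrFun hxy (a.incl b γ)
    rw [hval, hval] at this
    exact (e.trans (Function.Embedding.subtype P)).injective this
  have hfree : ∀ x ∈ freePart (M b) (Fin N), f x ∈ freePart G (Fin k) ∧ f x ∈ A := by
    intro x hx
    refine hV _ (fun γ h => ?_) (hmem x)
    rw [← hequi] at h
    by_contra hγ
    exact hx γ hγ (hinj h)
  refine ⟨fun x => ⟨f x, (hfree x x.2).1⟩, ?_, ?_, ?_, fun x => (hfree x x.2).2⟩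
  · intro x y h
    exact Subtype.ext (hinj (congrArg Subtype.val h))
  · exact (hf.comp measurable_subtype_coe).subtype_mk
  · intro γ x y h
    change f y = shift _ (f x)
    rw [h, hequi]

/-- The alternative between equivariant Borel injections for the two factors. -/
theorem exists_freePart_map_or [Countable G] [∀ b, Countable (M b)] {m n k : ℕ}
    (hk : m + n ≤ k + 1) {A : Set (G → Fin k)} (hA : MeasurableSet A) :
    (∃ f : freePart (M false) (Fin n) → freePart G (Fin k),
      Function.Injective f ∧ Measurable f ∧
      (∀ (γ : M false) (x y : freePart (M false) (Fin n)),
        (y : M false → Fin n) = shift γ (x : M false → Fin n) →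
        (f y : G → Fin k) = shift (a.incl false γ) (f x : G → Fin k)) ∧
      ∀ x, (f x : G → Fin k) ∈ A) ∨
    ∃ f : freePart (M true) (Fin m) → freePart G (Fin k),
      Function.Injective f ∧ Measurable f ∧
      (∀ (γ : M true) (x y : freePart (M true) (Fin m)),
        (y : M true → Fin m) = shift γ (x : M true → Fin m) →
        (f y : G → Fin k) = shift (a.incl true γ) (f x : G → Fin k)) ∧
      ∀ x, (f x : G → Fin k) ∈ Aᶜ := by
  classical
  let := shiftAction G (Fin k)
  have : MeasurableConstSMul G (G → Fin k) := ⟨fun γ => measurable_shift γ⟩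
  obtain ⟨D, hD, hsep⟩ := a.exists_separator (Z := G → Fin k)
  have hnf : ∀ y : G → Fin k, y ∉ freePart G (Fin k) → ∃ g : G, g ≠ 1 ∧ g • y = y := by
    intro y hy
    simp only [freePart, Set.mem_ofPred_eq] at hy
    push Not at hy
    exact hy
  have hfree : ∀ (γ : G) (y : G → Fin k), y ∈ freePart G (Fin k) ↔ γ • y ∈ freePart G (Fin k) := by
    intro γ y
    refine ⟨fun h => mem_freePart_of_shift (γ := γ⁻¹) ?_, mem_freePart_of_shift⟩
    change γ⁻¹ • γ • y ∈ _
    rwa [inv_smul_smul]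
  let V : Set (G → Fin k) := (freePart G (Fin k)).ite A Dᶜ
  have hV : MeasurableSet V := (measurableSet_freePart G k).ite hA hD.compl
  let P : Fin k → Prop := fun c => ∃ σ : ∀ t, (Fin t → Fin k) → Fin k, ∀ ρ : ℕ → Fin k,
    (∀ t, Turn true t → ρ t = σ t fun i => ρ i) → a.decode c ρ ∈ V
  have hP : ∀ c, ¬P c → ∃ σ : ∀ t, (Fin t → Fin k) → Fin k, ∀ ρ : ℕ → Fin k,
      (∀ t, Turn false t → ρ t = σ t fun i => ρ i) → a.decode c ρ ∈ Vᶜ := by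
    intro c hc
    have : Nonempty (Fin k) := ⟨c⟩
    rcases GameTree.determined_seq (V := (a.decode c ⁻¹' V)ᶜ) (a.measurable_decode c hV).compl with
      h | ⟨σ, h⟩
    · exact h
    · exact (hc ⟨σ, fun ρ hρ => not_not.1 (h ρ hρ)⟩).elim
  have hcard : Nat.card {c // P c} + Nat.card {c // ¬P c} = k := by
    rw [Nat.card_eq_fintype_card, Nat.card_eq_fintype_card, Fintype.card_subtype_compl,
      Fintype.card_fin]
    have := Fintype.card_subtype_le P
    rw [Fintype.card_fin] at this
    omega
  by_cases hn : n ≤ Nat.card {c // P c}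
  · refine .inl (a.exists_freePart_map false (V := V) (fun c hc => hc) hn fun y h1 h2 => ?_)
    by_cases hy : y ∈ freePart G (Fin k)
    · have := h2 1
      rw [map_one] at this
      have h3 : (1 : G) • y ∈ V := this
      rw [one_smul] at h3
      exact ⟨hy, (Set.ite_inter_self ..).subset ⟨h3, hy⟩ |>.1⟩
    · obtain ⟨γ, hγ⟩ := (hsep y (hnf y hy)).1 h1
      have hγy := mt (hfree (a.incl false γ) y).2 hy
      rcases h2 γ with h | h
      · exact (hγy h.2).elim
      · exact (h.1 hγ).elim
  · refine .inr (a.exists_freePart_map true (V := Vᶜ) hP (by omega) fun y h1 h2 => ?_)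
    by_cases hy : y ∈ freePart G (Fin k)
    · have := h2 1
      rw [map_one] at this
      have h3 : (1 : G) • y ∉ V := this
      rw [one_smul] at h3
      exact ⟨hy, fun h => h3 (.inl ⟨h, hy⟩)⟩
    · obtain ⟨γ, hγ⟩ := (hsep y (hnf y hy)).2 h1
      have hγy := mt (hfree (a.incl true γ) y).2 hy
      exact (h2 γ (.inr ⟨hγ, hγy⟩)).elim

end Alternation

/-- The main lemma for finite base spaces: for `m, n ≥ 2` and any Borel subset `A` of
`Free((m+n-1)^{Γ*Δ})`, either there is an injective Borel `Γ`-equivariant map from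
`Free(n^Γ)` into `A`, or there is an injective Borel `Δ`-equivariant map from
`Free(m^Δ)` into the complement of `A`. -/
theorem stmt_11 (Γ Δ : Type) [Group Γ] [Group Δ] [Countable Γ] [Countable Δ]
    (m n : ℕ) (hm : 2 ≤ m) (hn : 2 ≤ n)
    (A : Set ↥(freePart (Monoid.Coprod Γ Δ) (Fin (m + n - 1)))) (hA : MeasurableSet A) :
    (∃ f : ↥(freePart Γ (Fin n)) → ↥(freePart (Monoid.Coprod Γ Δ) (Fin (m + n - 1))),
      Function.Injective f ∧ Measurable f ∧
      (∀ (γ : Γ) (x y : ↥(freePart Γ (Fin n))),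
        (y : Γ → Fin n) = shift γ (x : Γ → Fin n) →
        (f y : Monoid.Coprod Γ Δ → Fin (m + n - 1)) =
          shift (Monoid.Coprod.inl γ) (f x : Monoid.Coprod Γ Δ → Fin (m + n - 1))) ∧
      Set.range f ⊆ A) ∨
    (∃ f : ↥(freePart Δ (Fin m)) → ↥(freePart (Monoid.Coprod Γ Δ) (Fin (m + n - 1))),
      Function.Injective f ∧ Measurable f ∧
      (∀ (δ : Δ) (x y : ↥(freePart Δ (Fin m))),
        (y : Δ → Fin m) = shift δ (x : Δ → Fin m) →
        (f y : Monoid.Coprod Γ Δ → Fin (m + n - 1)) =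
          shift (Monoid.Coprod.inr δ) (f x : Monoid.Coprod Γ Δ → Fin (m + n - 1))) ∧
      Set.range f ⊆ Aᶜ) := by
  obtain ⟨B, hB, rfl⟩ := hA
  obtain ⟨a, ha⟩ := Alternation.exists_coprod Γ Δ
  have : Countable (Monoid.Coprod Γ Δ) := a.num_injective.countable
  rcases a.exists_freePart_map_or (m := m) (n := n) (k := m + n - 1) (by omega) hB with
    ⟨f, h1, h2, h3, h4⟩ | ⟨f, h1, h2, h3, h4⟩
  · rw [ha] at h3
    exact .inl ⟨f, h1, h2, h3, Set.range_subset_iff.2 h4⟩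
  · rw [ha] at h3
    exact .inr ⟨f, h1, h2, h3, Set.range_subset_iff.2 h4⟩
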